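/- Let T be a tree whose trunk consists of exactly two vertices (i.e., T has exactly two vertices of degree ≥ 3 and they are adjacent). If F is any graph with X_F = X_T, then F ≅ T. -/

import Mathlib

open SimpleGraph

/-- Proper coloring for an edge set over `Sym2 V` (loops allowed): adjacent (or equal, for a
loop) endpoints must receive different colors. -/
def ProperCol {V : Type*} (E : Set (Sym2 V)) (k : V -> Nat) : Prop :=
  forall u v : V, s(u, v) ∈ E -> k u ≠ k v

/-- Weighted chromatic symmetric function `X_{(G,w)}` as a formal power series in the
variables `x_0, x_1, …` : the coefficient of a monomial `d` is the number of proper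
colorings whose total weight in color `i` is `d i` for every `i`. -/
noncomputable def csfW {V : Type*} (E : Set (Sym2 V)) (w : V -> Nat) : MvPowerSeries Nat Int :=
  fun d => (Nat.card {k : V -> Nat |
    ProperCol E k ∧ forall i : Nat, (∑ᶠ v ∈ {v : V | k v = i}, w v) = d i} : Int)

/-- Chromatic symmetric function `X_G` of a simple graph. -/
noncomputable def csf {V : Type*} (G : SimpleGraph V) : MvPowerSeries Nat Int :=
  csfW G.edgeSet (fun _ => 1)

/-- Degree of a vertex. -/
noncomputable def deg {V : Type*} (G : SimpleGraph V) (v : V) : Nat :=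
  Nat.card {u : V | G.Adj v u}

section ColorSum

open Classical in
/-- The sum over proper colorings `V → κ` of the product of the weights of the colors. -/
noncomputable def colorSum {V κ R : Type*} [Fintype V] [Fintype κ] [CommRing R]
    (G : SimpleGraph V) (y : κ → R) : R :=
  ∑ k : V → κ, if ∀ u v, G.Adj u v → k u ≠ k v then ∏ v, y (k v) else 0

lemma colorSum_eq_sum_filter {V κ R : Type*} [Fintype V] [Fintype κ] [CommRing R]
    (G : SimpleGraph V) (y : κ → R) [DecidablePred fun k : V → κ => ∀ u v, G.Adj u v → k u ≠ k v]
    (I : Fintype (V → κ)) :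
    colorSum G y =
      ∑ k ∈ Finset.univ.filter fun k : V → κ => ∀ u v, G.Adj u v → k u ≠ k v, ∏ v, y (k v) := by
  rw [Finset.sum_filter]
  unfold colorSum
  congr!

lemma colorSum_congr {V W κ κ' R : Type*} [Fintype V] [Fintype W] [Fintype κ] [Fintype κ']
    [CommRing R] {G : SimpleGraph V} {H : SimpleGraph W} (f : G ≃g H) (e : κ' ≃ κ)
    (y : κ → R) : colorSum G y = colorSum H (y ∘ e) := by
  classical
  unfold colorSum
  refine Fintype.sum_equiv (Equiv.arrowCongr f.toEquiv e.symm) _ _ fun k => ?_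
  have h1 : (∏ w, (y ∘ e) ((Equiv.arrowCongr f.toEquiv e.symm) k w)) = ∏ v, y (k v) := by
    refine (Fintype.prod_equiv f.toEquiv _ _ fun v => ?_).symm
    simp only [Equiv.arrowCongr, Equiv.coe_fn_mk, Function.comp_apply, Equiv.apply_symm_apply,
      Equiv.symm_apply_apply]
  rw [h1]
  congr 1
  simp only [eq_iff_iff, Equiv.arrowCongr, Equiv.coe_fn_mk, Function.comp_apply, ne_eq,
    EmbeddingLike.apply_eq_iff_eq]
  constructor
  · intro h u v huv
    exact h (f.symm u) (f.symm v) (f.symm.map_adj_iff.2 huv)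
  · intro h u v huv
    have := h (f u) (f v) (f.map_adj_iff.2 huv)
    rwa [show f.toEquiv.symm (f u) = u from f.toEquiv.symm_apply_apply u,
      show f.toEquiv.symm (f v) = v from f.toEquiv.symm_apply_apply v] at this

/-- The monomial of a coloring. -/
noncomputable def colorCount {V : Type*} [Fintype V] (k : V → ℕ) : ℕ →₀ ℕ :=
  ∑ v : V, Finsupp.single (k v) 1

lemma colorCount_apply {V : Type*} [Fintype V] (k : V → ℕ) (i : ℕ) :
    colorCount k i = (Finset.univ.filter fun v => k v = i).card := by
  simp [colorCount, Finsupp.finsetSum_apply, Finsupp.single_apply]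

lemma degree_colorCount {V : Type*} [Fintype V] (k : V → ℕ) :
    (colorCount k).degree = Fintype.card V := by
  simp [colorCount, map_sum]

lemma apply_mem_support_colorCount {V : Type*} [Fintype V] (k : V → ℕ) (v : V) :
    k v ∈ (colorCount k).support := by
  rw [Finsupp.mem_support_iff, colorCount_apply, Finset.card_ne_zero]
  exact ⟨v, by simp⟩

lemma coeff_csf {V : Type*} [Fintype V] (G : SimpleGraph V) (d : ℕ →₀ ℕ) :
    MvPowerSeries.coeff d (csf G) = (Nat.card {k : V → ℕ //
      (∀ u v, G.Adj u v → k u ≠ k v) ∧ colorCount k = d} : ℤ) := by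
  change csf G d = _
  simp only [csf, csfW, ProperCol, mem_edgeSet]
  congr 1
  refine Nat.card_congr (Equiv.subtypeEquivRight fun k => and_congr_right fun _ => ?_)
  rw [DFunLike.ext_iff]
  refine forall_congr' fun i => ?_
  rw [colorCount_apply, Finset.card_eq_sum_ones, finsum_mem_eq_finite_toFinset_sum _ (Set.toFinite _)]
  refine Eq.congr (Finset.sum_congr ?_ fun _ _ => rfl) rfl
  ext v
  simp

lemma card_eq_of_csf_eq {V W : Type*} [Fintype V] [Fintype W] {F : SimpleGraph W}
    {T : SimpleGraph V} (h : csf F = csf T) : Fintype.card W = Fintype.card V := by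
  classical
  let e := Fintype.equivFin V
  let k₀ : V → ℕ := fun v => e v
  have hT : MvPowerSeries.coeff (colorCount k₀) (csf T) ≠ 0 := by
    rw [coeff_csf]
    have : Finite {k : V → ℕ //
        (∀ u v, T.Adj u v → k u ≠ k v) ∧ colorCount k = colorCount k₀} := by
      refine Set.Finite.subset (Set.Finite.pi
        (fun _ : V => (colorCount k₀).support.finite_toSet)) ?_
      rintro k ⟨-, hk⟩ v -
      simpa [← hk] using apply_mem_support_colorCount k v
    have : Nonempty {k : V → ℕ //
        (∀ u v, T.Adj u v → k u ≠ k v) ∧ colorCount k = colorCount k₀} :=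
      ⟨⟨k₀, fun u v huv => Fin.val_injective.ne (e.injective.ne huv.ne), rfl⟩⟩
    exact_mod_cast Nat.card_pos.ne'
  rw [← h, coeff_csf] at hT
  obtain ⟨⟨k, -, hk⟩⟩ : Nonempty {k : W → ℕ //
      (∀ u v, F.Adj u v → k u ≠ k v) ∧ colorCount k = colorCount k₀} := by
    by_contra hne
    rw [not_nonempty_iff] at hne
    simp at hT
  rw [← degree_colorCount k, hk, degree_colorCount]

lemma colorSum_eq_sum_coeff_csf {V R : Type*} [Fintype V] [CommRing R] (G : SimpleGraph V) (N : ℕ)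
    (y : ℕ → R) : colorSum G (fun i : Fin N => y i) =
      ∑ d ∈ Finset.finsuppAntidiag (Finset.range N) (Fintype.card V),
        ((MvPowerSeries.coeff d (csf G) : ℤ) : R) * ∏ i ∈ Finset.range N, y i ^ d i := by
  classical
  let cnt (k : V → Fin N) : ℕ →₀ ℕ := colorCount fun v => (k v : ℕ)
  have hsupp (k : V → Fin N) : (cnt k).support ⊆ Finset.range N := by
    intro i hi
    rw [Finsupp.mem_support_iff, colorCount_apply, Finset.card_ne_zero] at hi
    obtain ⟨v, hv⟩ := hi
    simp [← (Finset.mem_filter.1 hv).2]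
  have hmem (k : V → Fin N) :
      cnt k ∈ Finset.finsuppAntidiag (Finset.range N) (Fintype.card V) := by
    rw [Finset.mem_finsuppAntidiag]
    refine ⟨?_, hsupp k⟩
    rw [← degree_colorCount fun v => (k v : ℕ), Finsupp.degree_apply]
    exact (Finset.sum_subset (hsupp k) (by simp)).symm
  rw [colorSum_eq_sum_filter, ← Finset.sum_fiberwise_of_maps_to (g := cnt) (fun k _ => hmem k)]
  refine Finset.sum_congr rfl fun d hd => ?_
  have hprod (k : V → Fin N) (hk : cnt k = d) :
      ∏ v, y (k v) = ∏ i ∈ Finset.range N, y i ^ d i := by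
    rw [← Finset.prod_fiberwise_of_maps_to (s := Finset.univ) (t := Finset.range N)
      (g := fun v => (k v : ℕ)) (by simp)]
    refine Finset.prod_congr rfl fun i hi => ?_
    rw [← hk, colorCount_apply, Finset.prod_congr rfl (g := fun _ => y i)
      (by simp +contextual), Finset.prod_const]
  rw [Finset.sum_congr rfl (g := fun _ => ∏ i ∈ Finset.range N, y i ^ d i)
    (by simp +contextual [hprod]), Finset.sum_const, nsmul_eq_mul]
  congr 1
  rw [coeff_csf, Finset.filter_filter]
  norm_cast
  rw [← Fintype.card_subtype, ← Nat.card_eq_fintype_card]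
  congr 1
  refine Nat.card_congr ⟨fun k => ⟨fun v => (k.1 v : ℕ), ?_, k.2.2⟩,
    fun k => ⟨fun v => ⟨k.1 v, ?_⟩, ?_, k.2.2⟩, ?_, ?_⟩
  · intro u v huv
    exact Fin.val_injective.ne (k.2.1 u v huv)
  · have := apply_mem_support_colorCount k.1 v
    rw [k.2.2] at this
    exact Finset.mem_range.1 ((Finset.mem_finsuppAntidiag.1 hd).2 this)
  · intro u v huv
    simpa using k.2.1 u v huv
  · intro k; rfl
  · intro k; rfl

theorem colorSum_eq_of_csf_eq {V W κ R : Type*} [Fintype V] [Fintype W] [Fintype κ] [CommRing R]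
    {F : SimpleGraph W} {T : SimpleGraph V} (h : csf F = csf T) (y : κ → R) :
    colorSum F y = colorSum T y := by
  classical
  let e := (Fintype.equivFin κ).symm
  let z : ℕ → R := fun i => if hi : i < Fintype.card κ then y (e ⟨i, hi⟩) else 0
  have hz : y ∘ e = fun i : Fin (Fintype.card κ) => z i := by
    funext i
    simp [z]
  rw [colorSum_congr (RelIso.refl _ : F ≃g F) e, colorSum_congr (RelIso.refl _ : T ≃g T) e, hz,
    colorSum_eq_sum_coeff_csf, colorSum_eq_sum_coeff_csf, h, card_eq_of_csf_eq h]

end ColorSum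

section Expansion

open Classical in
/-- The multiset of the orders of the connected components. -/
noncomputable def componentOrders {V : Type*} [Fintype V] (G : SimpleGraph V) : Multiset ℕ :=
  (Finset.univ : Finset G.ConnectedComponent).val.map fun C => C.supp.ncard

open Classical in
lemma sum_monochromatic {V κ R : Type*} [Fintype V] [Fintype κ] [CommRing R]
    (G : SimpleGraph V) (y : κ → R) :
    (∑ k : V → κ, if ∀ u v, G.Adj u v → k u = k v then ∏ v, y (k v) else 0) =
      ((componentOrders G).map fun m => ∑ c, y c ^ m).prod := by
  rw [componentOrders, Multiset.map_map, ← Finset.prod_eq_multiset_prod]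
  simp only [Function.comp_apply]
  rw [Finset.prod_univ_sum, Fintype.piFinset_univ, ← Finset.sum_filter]
  symm
  refine Finset.sum_bij (fun f _ v => f (G.connectedComponentMk v)) ?_ ?_ ?_ ?_
  · intro f _
    simp only [Finset.mem_filter, Finset.mem_univ, true_and]
    intro u v huv
    rw [ConnectedComponent.connectedComponentMk_eq_of_adj huv]
  · intro f _ g _ hfg
    funext C
    induction C using ConnectedComponent.ind with
    | h v => exact congrFun hfg v
  · intro k hk
    simp only [Finset.mem_filter, Finset.mem_univ, true_and] at hk
    have hr {u v : V} (p : G.Walk u v) : k u = k v := by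
      induction p with
      | nil => rfl
      | cons huv _ ih => exact (hk _ _ huv).trans ih
    exact ⟨fun C => C.lift k fun u v p _ => hr p, Finset.mem_univ _, rfl⟩
  · intro f _
    rw [← Finset.prod_fiberwise_of_maps_to (s := Finset.univ) (t := Finset.univ)
      (g := G.connectedComponentMk) (by simp)]
    refine Finset.prod_congr rfl fun C _ => ?_
    rw [Finset.prod_congr rfl (g := fun _ => y (f C)) (by simp +contextual), Finset.prod_const,
      Set.ncard_eq_toFinset_card']
    congr 2
    ext v
    simp

open Classical in
theorem colorSum_eq_sum_powerset {V κ R : Type*} [Fintype V] [Fintype κ] [CommRing R]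
    (G : SimpleGraph V) (y : κ → R) :
    colorSum G y = ∑ S ∈ G.edgeFinset.powerset, (-1) ^ S.card *
      ((componentOrders (fromEdgeSet (S : Set (Sym2 V)))).map fun m => ∑ c, y c ^ m).prod := by
  have key (k : V → κ) : (if ∀ u v, G.Adj u v → k u ≠ k v then ∏ v, y (k v) else 0) =
      ∑ S ∈ G.edgeFinset.powerset, (-1) ^ S.card *
        if ∀ u v, (fromEdgeSet (S : Set (Sym2 V))).Adj u v → k u = k v
        then ∏ v, y (k v) else 0 := by
    have h1 : (if ∀ u v, G.Adj u v → k u ≠ k v then (1 : R) else 0) =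
        ∏ e ∈ G.edgeFinset, ((if (e.map k).IsDiag then -1 else 0) + 1) := by
      split_ifs with h
      · refine (Finset.prod_eq_one fun e he => ?_).symm
        induction e with
        | h u v =>
          have := h u v (by simpa using he)
          simp [this]
      · push Not at h
        obtain ⟨u, v, huv, h⟩ := h
        exact (Finset.prod_eq_zero (i := s(u, v)) (by simpa using huv) (by simp [h])).symm
    rw [← mul_boole, h1, Finset.prod_add, Finset.mul_sum]
    refine Finset.sum_congr rfl fun S hS => ?_
    have h2 : (∏ e ∈ S, if (e.map k).IsDiag then (-1 : R) else 0) = (-1) ^ S.card *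
        if ∀ u v, (fromEdgeSet (S : Set (Sym2 V))).Adj u v → k u = k v then 1 else 0 := by
      split_ifs with h
      · rw [mul_one, ← Finset.prod_const]
        refine Finset.prod_congr rfl fun e he => if_pos ?_
        have hG : e ∈ G.edgeSet := by simpa using Finset.mem_powerset.1 hS he
        induction e with
        | h u v =>
          have := h u v (by simpa using ⟨he, hG.ne⟩)
          simp [this]
      · push Not at h
        obtain ⟨u, v, huv, h⟩ := h
        rw [mul_zero]
        refine Finset.prod_eq_zero (i := s(u, v)) ?_ (by simp [h])
        simpa using ((fromEdgeSet_adj _).1 huv).1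
    rw [h2, Finset.prod_const_one]
    split_ifs <;> ring
  unfold colorSum
  rw [Finset.sum_congr rfl fun k _ => key k, Finset.sum_comm]
  refine Finset.sum_congr rfl fun S _ => ?_
  rw [← Finset.mul_sum, ← sum_monochromatic]
  congr!

end Expansion

section Trees

lemma fromEdgeSet_coe_le {V : Type*} {G : SimpleGraph V} [Fintype G.edgeSet] {S : Finset (Sym2 V)}
    (hS : S ⊆ G.edgeFinset) : fromEdgeSet (S : Set (Sym2 V)) ≤ G := fun u v huv => by
  simpa using hS (((fromEdgeSet_adj _).1 huv).1)

lemma edgeFinset_fromEdgeSet_coe {V : Type*} {G : SimpleGraph V} [Fintype G.edgeSet]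
    {S : Finset (Sym2 V)} (hS : S ⊆ G.edgeFinset)
    [Fintype (fromEdgeSet (S : Set (Sym2 V))).edgeSet] :
    (fromEdgeSet (S : Set (Sym2 V))).edgeFinset = S := by
  ext e
  have : e ∈ S → ¬ e.IsDiag := fun he =>
    G.not_isDiag_of_mem_edgeSet (by simpa using hS he)
  simpa using this

open Classical in
lemma card_componentOrders {V : Type*} [Fintype V] (G : SimpleGraph V) :
    (componentOrders G).card = Nat.card G.ConnectedComponent := by
  rw [componentOrders, Multiset.card_map, Finset.card_val, Finset.card_univ,
    Nat.card_eq_fintype_card]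

open Classical in
lemma sum_componentOrders {V : Type*} [Fintype V] (G : SimpleGraph V) :
    (componentOrders G).sum = Fintype.card V := by
  rw [componentOrders, ← Finset.sum_eq_multiset_sum, ← Finset.card_univ (α := V),
    Finset.card_eq_sum_card_fiberwise (f := G.connectedComponentMk) (t := Finset.univ) (by simp)]
  refine Finset.sum_congr rfl fun C _ => ?_
  rw [Set.ncard_eq_toFinset_card']
  congr 1
  ext v
  simp

lemma card_componentOrders_add_card {V : Type*} [Fintype V] {G : SimpleGraph V}
    (hG : G.IsAcyclic) [Fintype G.edgeSet] :
    (componentOrders G).card + G.edgeFinset.card = Fintype.card V := by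
  classical
  have hdeg (C : G.ConnectedComponent) :
      ∑ v with G.connectedComponentMk v = C, G.degree v + 2 = 2 * C.supp.ncard := by
    have hT := hG.isTree_connectedComponent C
    have h1 := hT.card_edgeFinset
    have h2 := C.toSimpleGraph.sum_degrees_eq_twice_card_edges
    have h3 : ∑ v with G.connectedComponentMk v = C, G.degree v =
        ∑ v : C, C.toSimpleGraph.degree v := by
      rw [Finset.sum_subtype (p := fun v => v ∈ C.supp) _ (by simp)]
      refine Finset.sum_congr rfl fun v _ => ?_
      convert (degree_induce_of_neighborSet_subset (G := G) (s := C.supp) (v := v)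
        fun w hw => C.mem_supp_of_adj_mem_supp v.2 hw).symm using 1
      congr!
    have h4 : C.supp.ncard = Fintype.card C := by
      rw [← Nat.card_eq_fintype_card]; rfl
    omega
  have h1 : ∑ v, G.degree v = 2 * G.edgeFinset.card := by
    convert G.sum_degrees_eq_twice_card_edges
  rw [← Finset.sum_fiberwise_of_maps_to (s := Finset.univ) (t := Finset.univ)
      (g := G.connectedComponentMk) (by simp)] at h1
  have h2 := sum_componentOrders G
  rw [componentOrders, ← Finset.sum_eq_multiset_sum] at h2
  have h3 := Finset.sum_congr (s₁ := Finset.univ) rfl fun C _ => hdeg C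
  rw [Finset.sum_add_distrib, ← Finset.mul_sum, h1, h2] at h3
  rw [componentOrders, Multiset.card_map, Finset.card_val]
  simp only [Finset.sum_const, Finset.card_univ, smul_eq_mul] at h3 ⊢
  linarith

lemma colorSum_one_of_isTree {V κ R : Type*} [Fintype V] [Fintype κ] [CommRing R]
    {G : SimpleGraph V} (hG : G.IsTree) :
    colorSum G (fun _ : κ => (1 : R)) =
      Fintype.card κ * (Fintype.card κ - 1) ^ (Fintype.card V - 1) := by
  classical
  rw [colorSum_eq_sum_powerset, ← hG.card_edgeFinset, Nat.add_sub_cancel, sub_eq_neg_add,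
    ← Finset.sum_pow_mul_eq_add_pow, Finset.mul_sum]
  refine Finset.sum_congr rfl fun S hS => ?_
  rw [Finset.mem_powerset] at hS
  have h1 := card_componentOrders_add_card (hG.isAcyclic.anti (fromEdgeSet_coe_le hS))
  have h2 := hG.card_edgeFinset
  have h3 := Finset.card_le_card hS
  rw [edgeFinset_fromEdgeSet_coe hS] at h1
  have h4 : (componentOrders (fromEdgeSet (S : Set (Sym2 V)))).card =
    G.edgeFinset.card - S.card + 1 := by omega
  simp only [one_pow, Finset.sum_const, Finset.card_univ, Multiset.map_const',
    Multiset.prod_replicate, h4, nsmul_eq_mul, mul_one]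
  ring

lemma isTree_of_colorSum_eq {V W : Type*} [Fintype V] [Fintype W]
    {F : SimpleGraph W} {T : SimpleGraph V} (hT : T.IsTree) (hcard : Fintype.card W = Fintype.card V)
    (h1 : colorSum F (fun _ : Fin 2 => (1 : ℤ)) = colorSum T fun _ : Fin 2 => (1 : ℤ))
    (h2 : colorSum F (fun _ : W => (1 : ℤ)) = colorSum T fun _ : W => (1 : ℤ)) : F.IsTree := by
  classical
  have := hT.connected.nonempty
  have hW : Nonempty W := by
    rw [← Fintype.card_pos_iff, hcard]; exact Fintype.card_pos
  have hF : F.Connected := by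
    by_contra hF
    rw [colorSum_one_of_isTree hT, colorSum_eq_sum_powerset] at h1
    have h4 : (4 : ℤ) ∣ 2 := by
      have : (2 : ℤ) = (Fintype.card (Fin 2) * (Fintype.card (Fin 2) - 1) ^ (Fintype.card V - 1)) := by
        norm_num
      rw [this, ← h1]
      refine Finset.dvd_sum fun S hS => Dvd.dvd.mul_left ?_ _
      have h5 : 2 ≤ Nat.card F.ConnectedComponent := by
        by_contra! hlt
        apply hF
        have h6 : Subsingleton F.ConnectedComponent :=
          Finite.card_le_one_iff_subsingleton.1 (by omega)
        refine (connected_iff _).2 ⟨fun u v => ?_, hW⟩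
        exact ConnectedComponent.exact (Subsingleton.elim _ _)
      have h6 := fromEdgeSet_coe_le (Finset.mem_powerset.1 hS)
      have h7 := h5.trans (ConnectedComponent.card_le_card_of_le h6)
      rw [← card_componentOrders] at h7
      simp only [one_pow, Finset.sum_const, Finset.card_univ, Fintype.card_fin, Multiset.map_const',
        Multiset.prod_replicate]
      exact dvd_trans (by norm_num) (pow_dvd_pow _ h7)
    norm_num at h4
  obtain ⟨F', hle, hF'⟩ := hF.exists_isTree_le
  obtain rfl | hne := eq_or_ne F' F
  · exact hF'
  exfalso
  obtain ⟨u, v, huv, hn⟩ : ∃ u v, F.Adj u v ∧ ¬ F'.Adj u v := by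
    by_contra! hcon
    exact hne (le_antisymm hle hcon)
  have h3 : colorSum F (fun _ : W => (1 : ℤ)) = colorSum F' fun _ : W => (1 : ℤ) := by
    rw [h2, colorSum_one_of_isTree hT, colorSum_one_of_isTree hF', hcard]
  refine h3.not_lt ?_
  unfold colorSum
  refine Finset.sum_lt_sum (fun k _ => ?_) ⟨Function.update id v u, Finset.mem_univ _, ?_⟩
  · simp only [Finset.prod_const_one]
    split_ifs with ha hb
    · rfl
    · exact absurd (fun u v huv => ha u v (hle huv)) hb
    · norm_num
    · rfl
  · rw [if_neg, if_pos]
    · simp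
    · intro a b hab hk
      have := hab.ne
      simp only [Function.update_apply, id] at hk
      split_ifs at hk with h4 h5 h5
      · exact this (h4.trans h5.symm)
      · exact hn (h4 ▸ hk ▸ hab.symm)
      · exact hn (h5 ▸ hk ▸ hab)
      · exact this hk
    · intro hk
      exact hk u v huv (by simp [Function.update_apply])

end Trees

section SmallComponents

lemma supp_connectedComponentMk_eq {V : Type*} {H : SimpleGraph V} {A : Set V} {x : V} (hx : x ∈ A)
    (hA : ∀ u ∈ A, ∀ v, H.Adj u v → v ∈ A) (hr : ∀ u ∈ A, H.Reachable u x) :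
    (H.connectedComponentMk x).supp = A := by
  ext y
  rw [ConnectedComponent.mem_supp_iff, ConnectedComponent.eq]
  refine ⟨fun h => ?_, hr y⟩
  obtain ⟨p⟩ := h.symm
  clear h hr
  induction p with
  | nil => exact hx
  | cons h _ ih => exact ih (hA _ hx _ h)

open Classical in
lemma count_one_componentOrders {V : Type*} [Fintype V] {H : SimpleGraph V} {S : Finset (Sym2 V)}
    (hS : H.edgeSet = S) :
    (componentOrders H).count 1 = (Finset.univ.filter fun v => ∀ e ∈ S, v ∉ e).card := by
  simp only [← Finset.mem_coe, ← hS]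
  rw [componentOrders, Multiset.count_map]
  change (Finset.univ.filter _).card = _
  symm
  refine Finset.card_bij (fun v _ => H.connectedComponentMk v) ?_ ?_ ?_
  · simp only [Finset.mem_filter, Finset.mem_univ, true_and]
    intro v hv
    rw [supp_connectedComponentMk_eq (A := {v}) rfl, Set.ncard_singleton]
    · rintro _ rfl w hw
      exact absurd (Sym2.mem_mk_left _ _) (hv s(_, w) hw)
    · rintro _ rfl
      rfl
  · simp only [Finset.mem_filter, Finset.mem_univ, true_and]
    intro v hv w hw h
    obtain ⟨p⟩ := ConnectedComponent.exact h
    cases p with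
    | nil => rfl
    | cons h _ => exact absurd (Sym2.mem_mk_left _ _) (hv s(_, _) h)
  · simp only [Finset.mem_filter, Finset.mem_univ, true_and]
    intro C hC
    obtain ⟨v, hv⟩ := Set.ncard_eq_one.1 hC.symm
    have hvC : v ∈ C.supp := by rw [hv]; rfl
    refine ⟨v, fun e he hve => ?_, hvC⟩
    obtain ⟨w, rfl⟩ := Sym2.mem_iff_exists.1 hve
    have hw := C.mem_supp_of_adj_mem_supp hvC he
    rw [hv] at hw
    exact he.ne hw.symm

open Classical in
lemma count_two_componentOrders {V : Type*} [Fintype V] {H : SimpleGraph V} {S : Finset (Sym2 V)}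
    (hS : H.edgeSet = S) :
    (componentOrders H).count 2 =
      (S.filter fun e => ∀ f ∈ S, ∀ x, x ∈ e → x ∈ f → f = e).card := by
  have hadj {u v : V} : H.Adj u v ↔ s(u, v) ∈ S := by
    rw [← mem_edgeSet, hS, Finset.mem_coe]
  have hsupp {e : Sym2 V} (he : e ∈ S) (h : ∀ f ∈ S, ∀ x, x ∈ e → x ∈ f → f = e) {x : V}
      (hx : x ∈ e) : (H.connectedComponentMk x).supp = {y | y ∈ e} := by
    refine supp_connectedComponentMk_eq hx ?_ ?_
    · intro u hu v huv
      have := h s(u, v) (hadj.1 huv) u hu (Sym2.mem_mk_left _ _)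
      change v ∈ e
      rw [← this]
      exact Sym2.mem_mk_right _ _
    · obtain ⟨w, rfl⟩ := Sym2.mem_iff_exists.1 hx
      intro u hu
      obtain rfl | rfl := Sym2.mem_iff.1 hu
      · rfl
      · exact (hadj.2 he).symm.reachable
  have hout (e : Sym2 V) : (Quot.out e).1 ∈ e := by
    have h := Sym2.mem_mk_left (Quot.out e).1 (Quot.out e).2
    rwa [show s((Quot.out e).1, (Quot.out e).2) = e from Quot.out_eq e] at h
  rw [componentOrders, Multiset.count_map]
  change (Finset.univ.filter _).card = _
  symm
  refine Finset.card_bij (fun e _ => H.connectedComponentMk (Quot.out e).1) ?_ ?_ ?_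
  · simp only [Finset.mem_filter, Finset.mem_univ, true_and, and_imp]
    intro e he h
    rw [hsupp he h (hout e)]
    induction e with
    | h u v =>
      have : {y | y ∈ s(u, v)} = {u, v} := by ext; simp
      rw [this, Set.ncard_pair (hadj.2 he).ne]
  · simp only [Finset.mem_filter, and_imp]
    intro e he h f hf h' heq
    have := hsupp he h (hout e)
    rw [heq, hsupp hf h' (hout f)] at this
    exact (Sym2.ext fun x => Set.ext_iff.1 this x).symm
  · simp only [Finset.mem_filter, Finset.mem_univ, true_and]
    intro C hC
    obtain ⟨u, v, huv, hC⟩ := Set.ncard_eq_two.1 hC.symm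
    have huC : u ∈ C.supp := by simp [hC]
    have hvC : v ∈ C.supp := by simp [hC]
    have hinS {a b : V} (ha : a ∈ C.supp) (hab : H.Adj a b) : s(a, b) = s(u, v) := by
      have hb := C.mem_supp_of_adj_mem_supp ha hab
      have := hab.ne
      rw [hC] at ha hb
      simp only [Set.mem_insert_iff, Set.mem_singleton_iff] at ha hb
      grind
    have hmem : s(u, v) ∈ S := by
      obtain ⟨p⟩ := ConnectedComponent.exact (huC.trans hvC.symm)
      cases p with
      | nil => exact absurd rfl huv
      | cons h _ =>
        rw [← hinS huC h]
        exact hadj.1 h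
    refine ⟨s(u, v), ⟨hmem, fun f hf x hx hxf => ?_⟩, ?_⟩
    · obtain ⟨w, rfl⟩ := Sym2.mem_iff_exists.1 hxf
      refine hinS ?_ (hadj.2 hf)
      rw [hC]
      simpa using hx
    · have := hout s(u, v)
      have hx : (Quot.out s(u, v)).1 ∈ C.supp := by
        rw [hC]
        simpa using this
      exact hx

end SmallComponents

section SpecialColor

open Polynomial

lemma mul_coeff_one_multiset_prod {R : Type*} [CommRing R] {t : R} (s : Multiset R[X])
    (hs : ∀ p ∈ s, p.coeff 0 = t) :
    t * s.prod.coeff 1 = t ^ s.card * (s.map fun p => p.coeff 1).sum := by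
  induction s using Multiset.induction_on with
  | empty => simp [coeff_one]
  | cons p s ih =>
    have hs' : ∀ p ∈ s, p.coeff 0 = t := fun p hp => hs p (Multiset.mem_cons_of_mem hp)
    have h0 : s.prod.coeff 0 = t ^ s.card := by
      rw [coeff_zero_multiset_prod, Multiset.map_congr rfl hs', Multiset.map_const',
        Multiset.prod_replicate]
    rw [Multiset.prod_cons, mul_coeff_one, h0, hs p (Multiset.mem_cons_self p s), Multiset.card_cons,
      Multiset.map_cons, Multiset.sum_cons, mul_add, ih hs']
    ring

lemma eq_of_eval_natCast_eq {R : Type*} [CommRing R] [IsDomain R] [CharZero R] {p q : R[X]}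
    (h : ∀ n : ℕ, p.eval (n : R) = q.eval (n : R)) : p = q := by
  refine eq_of_infinite_eval_eq p q ((Set.infinite_range_of_injective Nat.cast_injective).mono ?_)
  rintro _ ⟨n, rfl⟩
  exact h n

/-- The coloring weights with `m` colors of weight `q` and `t` colors of weight `1`. -/
def specialWeight {R : Type*} [CommRing R] (q : R) (m t : ℕ) : Fin m ⊕ Fin t → R :=
  Sum.elim (fun _ => q) fun _ => 1

open Classical in
/-- The color sum for `specialWeight`, as a polynomial in the number of special colors. -/
noncomputable def specialPoly {V R : Type*} [Fintype V] [CommRing R] (G : SimpleGraph V) (q : R)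
    (t : ℕ) : R[X] :=
  ∑ S ∈ G.edgeFinset.powerset, C ((-1) ^ S.card) *
    ((componentOrders (fromEdgeSet (S : Set (Sym2 V)))).map fun m => C (t : R) + C (q ^ m) * X).prod

lemma eval_specialPoly {V R : Type*} [Fintype V] [CommRing R] (G : SimpleGraph V) (q : R)
    (m t : ℕ) : (specialPoly G q t).eval (m : R) = colorSum G (specialWeight q m t) := by
  classical
  rw [colorSum_eq_sum_powerset, specialPoly, eval_finsetSum]
  refine Finset.sum_congr rfl fun S _ => ?_
  rw [eval_mul, eval_C, eval_multiset_prod, Multiset.map_map]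
  congr 2
  refine Multiset.map_congr rfl fun j _ => ?_
  simp [specialWeight]
  ring

lemma specialPoly_eq {V W R : Type*} [Fintype V] [Fintype W] [CommRing R] [IsDomain R] [CharZero R]
    {F : SimpleGraph W} {T : SimpleGraph V} (h : csf F = csf T) (q : R) (t : ℕ) :
    specialPoly F q t = specialPoly T q t :=
  eq_of_eval_natCast_eq fun m => by
    rw [eval_specialPoly, eval_specialPoly, colorSum_eq_of_csf_eq h]

open Classical in
lemma mul_coeff_one_specialPoly {V R : Type*} [Fintype V] [CommRing R] (G : SimpleGraph V) (q : R)
    (t : ℕ) : t * (specialPoly G q t).coeff 1 = ∑ S ∈ G.edgeFinset.powerset, (-1) ^ S.card *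
      ((t : R) ^ (componentOrders (fromEdgeSet (S : Set (Sym2 V)))).card *
        ((componentOrders (fromEdgeSet (S : Set (Sym2 V)))).map fun m => q ^ m).sum) := by
  rw [specialPoly, finsetSum_coeff, Finset.mul_sum]
  refine Finset.sum_congr rfl fun S _ => ?_
  rw [coeff_C_mul, mul_left_comm, mul_coeff_one_multiset_prod (t := (t : R)), Multiset.card_map,
    Multiset.map_map]
  · congr 3
    refine Multiset.map_congr rfl fun j _ => ?_
    simp only [Function.comp_apply, coeff_add, coeff_C_mul, coeff_X_one, coeff_C_of_ne_zero one_ne_zero,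
      zero_add, mul_one]
  · simp

open Classical in
/-- The numbers of components of order `j` in the spanning subgraphs of a graph, counted with signs
and powers of `t`. -/
noncomputable def componentCount {V : Type*} [Fintype V] (G : SimpleGraph V) (j : ℕ) (t : ℤ) : ℤ :=
  ∑ S ∈ G.edgeFinset.powerset, (-1) ^ S.card *
    (t ^ (componentOrders (fromEdgeSet (S : Set (Sym2 V)))).card *
      (componentOrders (fromEdgeSet (S : Set (Sym2 V)))).count j)

lemma coeff_mul_coeff_one_specialPoly {V : Type*} [Fintype V] (G : SimpleGraph V) (j t : ℕ) :
    ((t : ℤ[X]) * (specialPoly G (X : ℤ[X]) t).coeff 1).coeff j = componentCount G j t := by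
  classical
  have hsum (s : Multiset ℕ) : (s.map fun m => (X : ℤ[X]) ^ m).sum.coeff j = s.count j := by
    induction s using Multiset.induction_on with
    | empty => simp
    | cons a s ih =>
      rw [Multiset.map_cons, Multiset.sum_cons, coeff_add, ih, coeff_X_pow, Multiset.count_cons]
      push_cast
      ring
  rw [mul_coeff_one_specialPoly, finsetSum_coeff, componentCount]
  refine Finset.sum_congr rfl fun S _ => ?_
  rw [← hsum, ← coeff_C_mul, ← coeff_C_mul]
  simp

theorem componentCount_eq_of_csf_eq {V W : Type*} [Fintype V] [Fintype W] {F : SimpleGraph W}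
    {T : SimpleGraph V} (h : csf F = csf T) (j t : ℕ) :
    componentCount F j t = componentCount T j t := by
  rw [← coeff_mul_coeff_one_specialPoly, ← coeff_mul_coeff_one_specialPoly, specialPoly_eq h]

end SpecialColor

section DegreeDistribution

open Polynomial

lemma eq_of_eval_ratio_eq {K : Type*} [CommRing K] [IsDomain K] [Algebra ℚ K] {p q : K[X]}
    (h : ∀ t : ℕ, 2 ≤ t → p.eval (algebraMap ℚ K (t / (t - 1))) =
      q.eval (algebraMap ℚ K (t / (t - 1)))) : p = q := by
  have hinj : Function.Injective fun t : ℕ => algebraMap ℚ K (((t + 2 : ℕ) : ℚ) / ((t + 2 : ℕ) - 1)) := by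
    intro a b hab
    have h1 := (algebraMap ℚ K).injective hab
    have ha : ((a + 2 : ℕ) : ℚ) - 1 ≠ 0 := by push_cast; linarith [(Nat.cast_nonneg a : (0 : ℚ) ≤ a)]
    have hb : ((b + 2 : ℕ) : ℚ) - 1 ≠ 0 := by push_cast; linarith [(Nat.cast_nonneg b : (0 : ℚ) ≤ b)]
    rw [div_eq_div_iff ha hb] at h1
    push_cast at h1
    have : (a : ℚ) = b := by linarith
    exact_mod_cast this
  refine eq_of_infinite_eval_eq p q ((Set.infinite_range_of_injective hinj).mono ?_)
  rintro _ ⟨t, rfl⟩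
  exact h _ (by omega)

lemma mul_eval_sum_X_pow {κ : Type*} {u : Finset κ} {c : κ → ℕ} {N t : ℕ} (ht : (t : ℚ) - 1 ≠ 0)
    (hc : ∀ i ∈ u, c i ≤ N) :
    (t - 1 : ℚ) ^ N * (∑ i ∈ u, (X : ℚ[X]) ^ c i).eval (algebraMap ℚ ℚ (t / (t - 1))) =
      ((∑ i ∈ u, (t : ℤ) ^ c i * (t - 1) ^ (N - c i) : ℤ) : ℚ) := by
  rw [eval_finsetSum, Finset.mul_sum]
  push_cast
  refine Finset.sum_congr rfl fun i hi => ?_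
  obtain ⟨d, hd⟩ := Nat.exists_eq_add_of_le (hc i hi)
  rw [hd, Nat.add_sub_cancel_left, eval_pow, eval_X, pow_add, mul_right_comm, ← mul_pow, mul_div_cancel₀]
  exact ht

lemma map_val_eq_of_sum_pow_eq {ι ι' : Type*} {s : Finset ι} {s' : Finset ι'} {a : ι → ℕ} {b : ι' → ℕ}
    {N : ℕ} (ha : ∀ i ∈ s, a i ≤ N) (hb : ∀ i ∈ s', b i ≤ N)
    (h : ∀ t : ℕ, 2 ≤ t → ∑ i ∈ s, (t : ℤ) ^ a i * (t - 1) ^ (N - a i) =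
      ∑ i ∈ s', (t : ℤ) ^ b i * (t - 1) ^ (N - b i)) : s.val.map a = s'.val.map b := by
  classical
  have hpoly : ∑ i ∈ s, (X : ℚ[X]) ^ a i = ∑ i ∈ s', X ^ b i := by
    refine eq_of_eval_ratio_eq fun t ht => ?_
    have ht' : (t : ℚ) - 1 ≠ 0 := by
      have : (2 : ℚ) ≤ t := by exact_mod_cast ht
      linarith
    have := mul_eval_sum_X_pow ht' ha
    rw [h t ht, ← mul_eval_sum_X_pow ht' hb] at this
    exact mul_left_cancel₀ (pow_ne_zero _ ht') this
  ext j
  have hj := congrArg (fun p : ℚ[X] => p.coeff j) hpoly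
  simp only [finsetSum_coeff, coeff_X_pow, Finset.sum_boole, Nat.cast_inj] at hj
  rw [Multiset.count_map, Multiset.count_map]
  exact hj

lemma sum_powerset_neg_one_pow {α R : Type*} [CommRing R] (A : Finset α) (t : R) {N : ℕ}
    (hN : A.card ≤ N) : ∑ S ∈ A.powerset, (-1) ^ S.card * t ^ (N - S.card) =
      t ^ (N - A.card) * (t - 1) ^ A.card := by
  rw [sub_eq_neg_add, ← Finset.sum_pow_mul_eq_add_pow, Finset.mul_sum]
  refine Finset.sum_congr rfl fun S hS => ?_
  have := Finset.card_le_card (Finset.mem_powerset.1 hS)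
  rw [show N - S.card = (N - A.card) + (A.card - S.card) by omega, pow_add]
  ring

open Classical in
lemma componentCount_eq_of_isTree {V : Type*} [Fintype V] {G : SimpleGraph V} (hG : G.IsTree)
    (j : ℕ) (t : ℤ) : componentCount G j t = ∑ S ∈ G.edgeFinset.powerset,
      (-1) ^ S.card * (t ^ (Fintype.card V - S.card) *
        (componentOrders (fromEdgeSet (S : Set (Sym2 V)))).count j) := by
  refine Finset.sum_congr rfl fun S hS => ?_
  rw [Finset.mem_powerset] at hS
  have := card_componentOrders_add_card (hG.isAcyclic.anti (fromEdgeSet_coe_le hS))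
  rw [edgeFinset_fromEdgeSet_coe hS] at this
  rw [← this, Nat.add_sub_cancel]

open Classical in
lemma componentCount_one {V : Type*} [Fintype V] {G : SimpleGraph V} (hG : G.IsTree) (t : ℤ) :
    componentCount G 1 t =
      ∑ v, t * (t ^ G.degree v * (t - 1) ^ (Fintype.card V - 1 - G.degree v)) := by
  have hE := hG.card_edgeFinset
  have key (v : V) : ∑ S ∈ (G.edgeFinset.filter (v ∉ ·)).powerset,
      (-1) ^ S.card * t ^ (Fintype.card V - S.card) =
        t * (t ^ G.degree v * (t - 1) ^ (Fintype.card V - 1 - G.degree v)) := by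
    have h1 : (G.edgeFinset.filter (v ∈ ·)).card = G.degree v := by
      rw [← card_incidenceFinset_eq_degree, incidenceFinset_eq_filter]
    have h2 := Finset.card_filter_add_card_filter_not (s := G.edgeFinset) (v ∈ ·)
    rw [sum_powerset_neg_one_pow _ _ (by omega), ← mul_assoc, ← pow_succ']
    congr 2 <;> omega
  rw [componentCount_eq_of_isTree hG, ← Finset.sum_congr rfl fun v _ => key v]
  have hind (v : V) : (G.edgeFinset.filter (v ∉ ·)).powerset =
      G.edgeFinset.powerset.filter fun S => ∀ e ∈ S, v ∉ e := by
    ext S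
    simp only [Finset.mem_powerset, Finset.mem_filter, Finset.subset_iff]
    exact ⟨fun h => ⟨fun e he => (h he).1, fun e he => (h he).2⟩,
      fun h e he => ⟨h.1 he, h.2 e he⟩⟩
  simp only [hind, Finset.sum_filter]
  rw [Finset.sum_comm]
  refine Finset.sum_congr rfl fun S hS => ?_
  rw [Finset.mem_powerset] at hS
  have hS' : (fromEdgeSet (S : Set (Sym2 V))).edgeSet = S := by
    rw [← edgeFinset_fromEdgeSet_coe hS, coe_edgeFinset]
    simp
  rw [count_one_componentOrders hS', ← Finset.sum_filter, Finset.sum_const]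
  rw [nsmul_eq_mul]
  ring

open Classical in
/-- The number of edges having a common endpoint with a given edge, itself included. -/
noncomputable def meetCount {V : Type*} [Fintype V] (G : SimpleGraph V) (e : Sym2 V) : ℕ :=
  (G.edgeFinset.filter fun f => ∃ x, x ∈ e ∧ x ∈ f).card

open Classical in
lemma meetCount_add_one {V : Type*} [Fintype V] {G : SimpleGraph V} {u v : V} (h : G.Adj u v) :
    meetCount G s(u, v) + 1 = G.degree u + G.degree v := by
  have h1 : G.edgeFinset.filter (fun f => ∃ x, x ∈ s(u, v) ∧ x ∈ f) =
      G.incidenceFinset u ∪ G.incidenceFinset v := by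
    ext f
    simp [incidenceFinset_eq_filter]
    tauto
  have h2 : G.incidenceFinset u ∩ G.incidenceFinset v = {s(u, v)} := by
    ext f
    simp only [incidenceFinset_eq_filter, Finset.mem_inter, Finset.mem_filter, Finset.mem_singleton]
    constructor
    · rintro ⟨⟨-, hu⟩, -, hv⟩
      exact ((Sym2.mem_and_mem_iff h.ne).1 ⟨hu, hv⟩)
    · rintro rfl
      simpa using h
  have h3 := Finset.card_union_add_card_inter (G.incidenceFinset u) (G.incidenceFinset v)
  rwa [h2, Finset.card_singleton, card_incidenceFinset_eq_degree, card_incidenceFinset_eq_degree,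
    ← h1] at h3

open Classical in
lemma componentCount_two {V : Type*} [Fintype V] {G : SimpleGraph V} (hG : G.IsTree) (t : ℤ) :
    componentCount G 2 t =
      - ∑ e ∈ G.edgeFinset,
        t ^ meetCount G e * (t - 1) ^ (Fintype.card V - 1 - meetCount G e) := by
  have hE := hG.card_edgeFinset
  have key (e : Sym2 V) (he : e ∈ G.edgeFinset) : ∑ S ∈ G.edgeFinset.powerset.filter
      (fun S => e ∈ S ∧ ∀ f ∈ S, ∀ x, x ∈ e → x ∈ f → f = e),
      (-1) ^ S.card * t ^ (Fintype.card V - S.card) =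
        - (t ^ meetCount G e * (t - 1) ^ (Fintype.card V - 1 - meetCount G e)) := by
    let A := G.edgeFinset.filter fun f => ¬ ∃ x, x ∈ e ∧ x ∈ f
    have heA {S : Finset (Sym2 V)} (hS : S ⊆ A) : e ∉ S := by
      intro h
      have := (Finset.mem_filter.1 (hS h)).2
      induction e with
      | h u v => exact this ⟨u, by simp, by simp⟩
    have h2 := Finset.card_filter_add_card_filter_not (s := G.edgeFinset) fun f => ∃ x, x ∈ e ∧ x ∈ f
    change meetCount G e + A.card = _ at h2
    have h3 := sum_powerset_neg_one_pow A t (N := Fintype.card V - 1) (by omega)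
    rw [show Fintype.card V - 1 - meetCount G e = A.card by omega,
      show meetCount G e = Fintype.card V - 1 - A.card by omega, ← h3, ← Finset.sum_neg_distrib]
    refine (Finset.sum_nbij' (insert e) (fun S => S.erase e) ?_ ?_ ?_ ?_ ?_).symm
    · intro S hS
      rw [Finset.mem_powerset] at hS
      simp only [Finset.mem_filter, Finset.mem_powerset, Finset.mem_insert_self, true_and]
      refine ⟨Finset.insert_subset he (hS.trans (Finset.filter_subset _ _)), fun f hf x hxe hxf => ?_⟩
      obtain rfl | hf := Finset.mem_insert.1 hf
      · rfl
      · exact absurd ⟨x, hxe, hxf⟩ (Finset.mem_filter.1 (hS hf)).2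
    · intro S hS
      simp only [Finset.mem_filter, Finset.mem_powerset] at hS ⊢
      intro f hf
      refine Finset.mem_filter.2 ⟨hS.1 (Finset.mem_of_mem_erase hf), ?_⟩
      rintro ⟨x, hxe, hxf⟩
      exact Finset.ne_of_mem_erase hf (hS.2.2 f (Finset.mem_of_mem_erase hf) x hxe hxf)
    · intro S hS
      exact Finset.erase_insert (heA (Finset.mem_powerset.1 hS))
    · intro S hS
      exact Finset.insert_erase (Finset.mem_filter.1 hS).2.1
    · intro S hS
      rw [Finset.card_insert_of_notMem (heA (Finset.mem_powerset.1 hS)), add_comm S.card 1,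
        Nat.sub_add_eq]
      ring
  rw [componentCount_eq_of_isTree hG, ← Finset.sum_neg_distrib, ← Finset.sum_congr rfl key]
  simp only [Finset.sum_filter]
  rw [Finset.sum_comm]
  refine Finset.sum_congr rfl fun S hS => ?_
  rw [Finset.mem_powerset] at hS
  have hS' : (fromEdgeSet (S : Set (Sym2 V))).edgeSet = S := by
    rw [← edgeFinset_fromEdgeSet_coe hS, coe_edgeFinset]
    simp
  rw [count_two_componentOrders hS', ← Finset.sum_filter, Finset.sum_const]
  have : G.edgeFinset.filter (fun e => e ∈ S ∧ ∀ f ∈ S, ∀ x, x ∈ e → x ∈ f → f = e) =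
      S.filter fun e => ∀ f ∈ S, ∀ x, x ∈ e → x ∈ f → f = e := by
    ext e
    simp only [Finset.mem_filter]
    exact ⟨fun h => h.2, fun h => ⟨hS h.1, h⟩⟩
  rw [this, nsmul_eq_mul]
  ring

end DegreeDistribution

section Trunk

open Classical in
lemma isTree_of_csf_eq {V W : Type*} [Fintype V] [Fintype W] {F : SimpleGraph W}
    {T : SimpleGraph V} (hT : T.IsTree) (h : csf F = csf T) : F.IsTree :=
  isTree_of_colorSum_eq hT (card_eq_of_csf_eq h) (colorSum_eq_of_csf_eq h _)
    (colorSum_eq_of_csf_eq h _)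

open Classical in
lemma map_degree_eq_of_csf_eq {V W : Type*} [Fintype V] [Fintype W] {F : SimpleGraph W}
    {T : SimpleGraph V} (hT : T.IsTree) (h : csf F = csf T) :
    Finset.univ.val.map (fun w => F.degree w) = Finset.univ.val.map fun v => T.degree v := by
  have hF := isTree_of_csf_eq hT h
  refine map_val_eq_of_sum_pow_eq (N := Fintype.card V - 1)
    (fun w _ => ?_) (fun v _ => Nat.le_sub_one_of_lt (T.degree_lt_card_verts v)) fun t ht => ?_
  · rw [← card_eq_of_csf_eq h]
    exact Nat.le_sub_one_of_lt (F.degree_lt_card_verts w)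
  · have h1 := componentCount_eq_of_csf_eq h 1 t
    rw [componentCount_one hF, componentCount_one hT, ← Finset.mul_sum, ← Finset.mul_sum,
      card_eq_of_csf_eq h] at h1
    exact mul_left_cancel₀ (by positivity) h1

open Classical in
lemma map_meetCount_eq_of_csf_eq {V W : Type*} [Fintype V] [Fintype W] {F : SimpleGraph W}
    {T : SimpleGraph V} (hT : T.IsTree) (h : csf F = csf T) :
    F.edgeFinset.val.map (meetCount F) = T.edgeFinset.val.map (meetCount T) := by
  have hF := isTree_of_csf_eq hT h
  refine map_val_eq_of_sum_pow_eq (N := Fintype.card V - 1)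
    (fun e _ => ?_) (fun e _ => ?_) fun t _ => ?_
  · rw [← card_eq_of_csf_eq h, ← hF.card_edgeFinset, Nat.add_sub_cancel]
    exact Finset.card_filter_le _ _
  · rw [← hT.card_edgeFinset, Nat.add_sub_cancel]
    exact Finset.card_filter_le _ _
  · have h1 := componentCount_eq_of_csf_eq h 2 t
    rw [componentCount_two hF, componentCount_two hT, card_eq_of_csf_eq h] at h1
    exact neg_injective h1

open Classical in
theorem exists_trunk_of_csf_eq {V W : Type*} [Fintype V] [Fintype W] {F : SimpleGraph W}
    {T : SimpleGraph V} (hT : T.IsTree) (h : csf F = csf T) {a b : V} (hab : T.Adj a b)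
    (hbig : ∀ v, 3 ≤ T.degree v ↔ v = a ∨ v = b) :
    ∃ u v, F.Adj u v ∧ (∀ w, 3 ≤ F.degree w ↔ w = u ∨ w = v) ∧
      F.degree u + F.degree v = T.degree a + T.degree b := by
  have hdeg := map_degree_eq_of_csf_eq hT h
  obtain ⟨e, he, heq⟩ : ∃ e ∈ F.edgeFinset, meetCount F e = meetCount T s(a, b) := by
    have : meetCount T s(a, b) ∈ F.edgeFinset.val.map (meetCount F) := by
      rw [map_meetCount_eq_of_csf_eq hT h]
      exact Multiset.mem_map_of_mem _ (by simpa using hab)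
    simpa using this
  induction e with
  | h u v =>
    have huv : F.Adj u v := by simpa using he
    have hsum : F.degree u + F.degree v = T.degree a + T.degree b := by
      rw [← meetCount_add_one huv, ← meetCount_add_one hab, heq]
    have ha := (hbig a).2 (Or.inl rfl)
    have hb := (hbig b).2 (Or.inr rfl)
    have hmax (w : W) : F.degree w ≤ 2 ∨ F.degree w = T.degree a ∨ F.degree w = T.degree b := by
      have : F.degree w ∈ Finset.univ.val.map fun v => T.degree v := by
        rw [← hdeg]
        exact Multiset.mem_map_of_mem _ (Finset.mem_univ w)
      obtain ⟨x, -, hx⟩ := Multiset.mem_map.1 this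
      by_cases h3 : 3 ≤ T.degree x
      · obtain rfl | rfl := (hbig x).1 h3 <;> simp [hx]
      · omega
    have hu := hmax u
    have hv := hmax v
    have hcard : (Finset.univ.filter fun w => 3 ≤ F.degree w).card = 2 := by
      have h1 : (Finset.univ.filter fun w => 3 ≤ T.degree w) = {a, b} := by
        ext x
        simp [hbig]
      rw [← Finset.card_pair hab.ne, ← h1]
      have h2 := congrArg (Multiset.countP (3 ≤ ·)) hdeg
      rw [Multiset.countP_map, Multiset.countP_map] at h2
      exact h2
    have hpair : {u, v} = Finset.univ.filter fun w => 3 ≤ F.degree w := by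
      refine Finset.eq_of_subset_of_card_le ?_ ?_
      · intro x hx
        simp only [Finset.mem_insert, Finset.mem_singleton] at hx
        simp only [Finset.mem_filter, Finset.mem_univ, true_and]
        obtain rfl | rfl := hx <;> omega
      · rw [hcard, Finset.card_pair huv.ne]
    refine ⟨u, v, huv, fun w => ?_, hsum⟩
    have := Finset.ext_iff.1 hpair w
    simpa [iff_comm] using this

end Trunk

section Model

/-- Two adjacent hubs `inl true`, `inl false`, and infinite legs indexed by `ι`, where the leg `i`
is attached to the hub `σ i`; here `parentRel σ p q` says that `p` hangs from `q`. -/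
def parentRel {ι : Type*} (σ : ι → Bool) : Bool ⊕ ι × ℕ → Bool ⊕ ι × ℕ → Prop
  | .inl x, .inl y => x ≠ y
  | .inr (i, 0), .inl x => σ i = x
  | .inr (i, j + 1), .inr (i', j') => i = i' ∧ j = j'
  | _, _ => False

/-- The graph of `parentRel`. -/
def legGraph {ι : Type*} (σ : ι → Bool) : SimpleGraph (Bool ⊕ ι × ℕ) where
  Adj p q := parentRel σ p q ∨ parentRel σ q p
  symm := ⟨fun _ _ => Or.symm⟩
  loopless := ⟨by rintro (x | ⟨i, _ | j⟩) <;> simp [parentRel]⟩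

@[simp] lemma legGraph_adj_inl_inl {ι : Type*} (σ : ι → Bool) (x y : Bool) :
    (legGraph σ).Adj (.inl x) (.inl y) ↔ x ≠ y := by
  simp only [legGraph, parentRel]; grind

@[simp] lemma legGraph_adj_inr_inl {ι : Type*} (σ : ι → Bool) (i : ι) (j : ℕ) (x : Bool) :
    (legGraph σ).Adj (.inr (i, j)) (.inl x) ↔ j = 0 ∧ σ i = x := by
  cases j <;> simp [legGraph, parentRel]

@[simp] lemma legGraph_adj_inl_inr {ι : Type*} (σ : ι → Bool) (i : ι) (j : ℕ) (x : Bool) :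
    (legGraph σ).Adj (.inl x) (.inr (i, j)) ↔ j = 0 ∧ σ i = x := by
  rw [adj_comm, legGraph_adj_inr_inl]

@[simp] lemma legGraph_adj_inr_inr {ι : Type*} (σ : ι → Bool) (i i' : ι) (j j' : ℕ) :
    (legGraph σ).Adj (.inr (i, j)) (.inr (i', j')) ↔ i = i' ∧ (j = j' + 1 ∨ j' = j + 1) := by
  cases j <;> cases j' <;> simp [legGraph, parentRel] <;> grind

/-- An embedding `c` of `T` as the two hubs together with the first `ℓ i` vertices of each
leg `i`. -/
structure IsLegModel {V ι : Type*} (T : SimpleGraph V) (a b : V) (σ : ι → Bool) (ℓ : ι → ℕ)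
    (c : V → Bool ⊕ ι × ℕ) : Prop where
  injective : Function.Injective c
  map_left : c a = .inl true
  map_right : c b = .inl false
  pos : ∀ i, 0 < ℓ i
  mem_range : ∀ i j, (∃ v, c v = .inr (i, j)) ↔ j < ℓ i
  adj_iff : ∀ u v, T.Adj u v ↔ (legGraph σ).Adj (c u) (c v)

open Classical in
/-- Extend coordinates on the complement of `v` by giving `v` the coordinate `p`. -/
noncomputable def extendCoord {V M M' : Type*} {v : V} (c : ({v}ᶜ : Set V) → M) (φ : M → M')
    (p : M') (w : V) : M' :=
  if h : w = v then p else φ (c ⟨w, h⟩)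

@[simp] lemma extendCoord_self {V M M' : Type*} {v : V} (c : ({v}ᶜ : Set V) → M) (φ : M → M')
    (p : M') : extendCoord c φ p v = p := by
  simp [extendCoord]

@[simp] lemma extendCoord_coe {V M M' : Type*} {v : V} (c : ({v}ᶜ : Set V) → M) (φ : M → M')
    (p : M') (w : ({v}ᶜ : Set V)) : extendCoord c φ p w = φ (c w) := by
  have : (w : V) ≠ v := w.2
  simp [extendCoord, this]

lemma forall_iff_compl_singleton {V : Type*} (v : V) {P : V → Prop} :
    (∀ w, P w) ↔ P v ∧ ∀ w : ({v}ᶜ : Set V), P w := by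
  refine ⟨fun h => ⟨h _, fun w => h _⟩, fun h w => ?_⟩
  by_cases hw : w = v
  · exact hw ▸ h.1
  · exact h.2 ⟨w, hw⟩

lemma exists_iff_compl_singleton {V : Type*} (v : V) {P : V → Prop} :
    (∃ w, P w) ↔ P v ∨ ∃ w : ({v}ᶜ : Set V), P w := by
  have := forall_iff_compl_singleton v (P := fun w => ¬ P w)
  rw [← not_iff_not]
  push Not
  exact this

lemma IsLegModel.extend {V ι ι' : Type*} {T : SimpleGraph V} {v u : V} (hu : T.Adj v u)
    (huniq : ∀ w, T.Adj v w → w = u) {a b : ({v}ᶜ : Set V)} {σ : ι → Bool} {ℓ : ι → ℕ}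
    {c : ({v}ᶜ : Set V) → Bool ⊕ ι × ℕ} (hc : IsLegModel (T.induce {v}ᶜ) a b σ ℓ c)
    {σ' : ι' → Bool} {ℓ' : ι' → ℕ} (e : ι ↪ ι') (he : ∀ i, σ' (e i) = σ i) (hpos : ∀ i, 0 < ℓ' i)
    (k : ι') (m : ℕ)
    (hℓ : ∀ i j, j < ℓ' i ↔ (i = k ∧ j = m) ∨ ∃ i', e i' = i ∧ j < ℓ i')
    (hnew : ∀ i, e i = k → ¬ m < ℓ i)
    (hadj : ∀ w : ({v}ᶜ : Set V), (legGraph σ').Adj (.inr (k, m))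
      (Sum.map id (Prod.map e id) (c w)) ↔ (w : V) = u) :
    IsLegModel T a b σ' ℓ' (extendCoord c (Sum.map id (Prod.map e id)) (.inr (k, m))) := by
  have hφ : Function.Injective (Sum.map (id : Bool → Bool) (Prod.map e (id : ℕ → ℕ))) :=
    Function.injective_id.sumMap (e.injective.prodMap Function.injective_id)
  have hφadj (p q) : (legGraph σ').Adj (Sum.map id (Prod.map e id) p)
      (Sum.map id (Prod.map e id) q) ↔ (legGraph σ).Adj p q := by
    rcases p with x | ⟨i, j⟩ <;> rcases q with y | ⟨i', j'⟩ <;> simp [he]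
  have hne (w : ({v}ᶜ : Set V)) : Sum.map id (Prod.map e id) (c w) ≠ .inr (k, m) := by
    intro h
    rcases hw : c w with x | ⟨i, j⟩
    · simp [hw] at h
    · simp only [hw, Sum.map_inr, Prod.map_apply, id_eq, Sum.inr.injEq, Prod.mk.injEq] at h
      exact hnew i h.1 (h.2 ▸ (hc.mem_range i j).1 ⟨w, hw⟩)
  refine ⟨?_, ?_, ?_, hpos, fun i j => ?_, ?_⟩
  · have : ∀ w w', extendCoord c (Sum.map id (Prod.map e id)) (.inr (k, m)) w =
        extendCoord c (Sum.map id (Prod.map e id)) (.inr (k, m)) w' → w = w' := by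
      rw [forall_iff_compl_singleton v]
      refine ⟨?_, fun w => ?_⟩ <;> rw [forall_iff_compl_singleton v]
      · simp only [extendCoord_self, extendCoord_coe, true_and, imp_self]
        exact fun w h => absurd h.symm (hne w)
      · simp only [extendCoord_self, extendCoord_coe]
        exact ⟨fun h => absurd h (hne w), fun w' h => congrArg _ (hc.injective (hφ h))⟩
    exact fun w w' => this w w'
  · simp [hc.map_left]
  · simp [hc.map_right]
  · rw [exists_iff_compl_singleton v, hℓ]
    simp only [extendCoord_self, extendCoord_coe, Sum.inr.injEq, Prod.mk.injEq]
    refine or_congr (by grind) ⟨?_, ?_⟩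
    · rintro ⟨w, hw⟩
      rcases hcw : c w with x | ⟨i', j'⟩
      · simp [hcw] at hw
      · simp only [hcw, Sum.map_inr, Prod.map_apply, id_eq, Sum.inr.injEq, Prod.mk.injEq] at hw
        exact ⟨i', hw.1, hw.2 ▸ (hc.mem_range _ _).1 ⟨w, hcw⟩⟩
    · rintro ⟨i', rfl, hj⟩
      obtain ⟨w, hw⟩ := (hc.mem_range _ _).2 hj
      exact ⟨w, by simp [hw]⟩
  · have hvw (w : ({v}ᶜ : Set V)) : T.Adj v w ↔ (w : V) = u :=
      ⟨huniq _, fun h => h ▸ hu⟩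
    rw [forall_iff_compl_singleton v]
    refine ⟨?_, fun w => ?_⟩ <;> rw [forall_iff_compl_singleton v] <;>
      simp only [extendCoord_self, extendCoord_coe, SimpleGraph.irrefl, true_and]
    · intro w
      rw [hadj, hvw]
    · refine ⟨?_, fun w' => ?_⟩
      · rw [adj_comm, hvw, adj_comm, hadj]
      · rw [hφadj, ← hc.adj_iff]
        rfl

lemma exists_isLegModel_of_subsingleton_compl {V : Type*} {T : SimpleGraph V} {a b : V}
    (hab : T.Adj a b) (hV : ∀ w, w = a ∨ w = b) :
    ∃ (ι : Type) (_ : Fintype ι) (σ : ι → Bool) (ℓ : ι → ℕ) (c : V → Bool ⊕ ι × ℕ),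
      IsLegModel T a b σ ℓ c := by
  classical
  have hne := hab.ne
  refine ⟨Empty, inferInstance, Empty.elim, Empty.elim, fun w => .inl (decide (w = a)), ?_, ?_, ?_,
    fun i => i.elim, fun i => i.elim, fun u v => ?_⟩
  · intro w w' h
    have := hV w
    have := hV w'
    simp only [Sum.inl.injEq, decide_eq_decide] at h
    grind
  · simp
  · simpa using hne.symm
  · rw [legGraph_adj_inl_inl]
    obtain rfl | rfl := hV u <;> obtain rfl | rfl := hV v <;>
      simp_all [adj_comm, hne.symm]

open Classical in
theorem exists_isLegModel {V : Type*} [Fintype V] {T : SimpleGraph V} (hT : T.IsTree) {a b : V}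
    (hab : T.Adj a b) (hdeg : ∀ v, v ≠ a → v ≠ b → ∀ x y z, T.Adj v x → T.Adj v y → T.Adj v z →
      x = y ∨ x = z ∨ y = z) :
    ∃ (ι : Type) (_ : Fintype ι) (σ : ι → Bool) (ℓ : ι → ℕ) (c : V → Bool ⊕ ι × ℕ),
      IsLegModel T a b σ ℓ c := by
  induction hn : Fintype.card V generalizing V with
  | zero => exact ((Fintype.card_eq_zero_iff.1 hn).false a).elim
  | succ n ih =>
    by_cases hleaf : ∃ v, v ≠ a ∧ v ≠ b ∧ T.degree v = 1
    · obtain ⟨v, hva, hvb, hv⟩ := hleaf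
      obtain ⟨u, hvu, huniq⟩ := degree_eq_one_iff_existsUnique_adj.mp hv
      have hcard : Fintype.card ({v}ᶜ : Set V) = n := by
        rw [Fintype.card_compl_set, hn, ← Nat.card_eq_fintype_card, Nat.card_unique,
          Nat.add_sub_cancel]
      have ha : a ∈ ({v}ᶜ : Set V) := fun h => hva h.symm
      have hb : b ∈ ({v}ᶜ : Set V) := fun h => hvb h.symm
      obtain ⟨ι, _, σ, ℓ, c, hc⟩ := ih (T := T.induce {v}ᶜ)
        ⟨hT.connected.induce_compl_singleton_of_degree_eq_one hv, hT.isAcyclic.induce _⟩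
        (a := ⟨a, ha⟩) (b := ⟨b, hb⟩) hab
        (fun w hwa hwb x y z hx hy hz => by
          have := hdeg w (fun h => hwa (Subtype.ext h)) (fun h => hwb (Subtype.ext h)) x y z
            hx hy hz
          simpa only [Subtype.ext_iff] using this) hcard
      have hu : u ∈ ({v}ᶜ : Set V) := hvu.ne'
      rcases hcu : c ⟨u, hu⟩ with x | ⟨i, j⟩
      · refine ⟨Option ι, inferInstance, fun o => o.elim x σ, fun o => o.elim 1 ℓ, _,
          hc.extend (a := ⟨a, ha⟩) (b := ⟨b, hb⟩) hvu huniq Function.Embedding.some (fun _ => rfl)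
          ?_ none 0 ?_ (by simp) ?_⟩
        · rintro (_ | i)
          exacts [one_pos, hc.pos i]
        · rintro (_ | i) j <;> simp
        · intro w
          have : (w : V) = u ↔ w = ⟨u, hu⟩ := by rw [Subtype.ext_iff]
          rw [this, ← hc.injective.eq_iff, hcu]
          rcases c w with y | ⟨i, j⟩
          · simp [eq_comm]
          · simp
      · have hj : j < ℓ i := (hc.mem_range i j).1 ⟨_, hcu⟩
        have hj1 : ℓ i = j + 1 := by
          by_contra hne
          obtain ⟨y, hy⟩ := (hc.mem_range i (j + 1)).2 (by omega)
          obtain ⟨z, hz, hzu⟩ : ∃ z, c z ≠ .inr (i, j + 1) ∧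
              (legGraph σ).Adj (.inr (i, j)) (c z) := by
            rcases j with _ | j
            · rcases hσ : σ i with _ | _
              · exact ⟨_, by rw [hc.map_right]; simp, by rw [hc.map_right]; simp [hσ]⟩
              · exact ⟨_, by rw [hc.map_left]; simp, by rw [hc.map_left]; simp [hσ]⟩
            · obtain ⟨z, hz⟩ := (hc.mem_range i j).2 (by omega)
              exact ⟨z, by rw [hz]; simp; omega, by rw [hz]; simp⟩
          have h1 : T.Adj u y := by
            have := (hc.adj_iff ⟨u, hu⟩ y).2 (by rw [hcu, hy]; simp)
            exact this
          have h2 : T.Adj u z := by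
            have := (hc.adj_iff ⟨u, hu⟩ z).2 (by rw [hcu]; exact hzu)
            exact this
          rcases hdeg u (by rintro rfl; simp [hc.map_left] at hcu)
            (by rintro rfl; simp [hc.map_right] at hcu) v y z hvu.symm h1 h2 with h | h | h
          · exact y.2 h.symm
          · exact z.2 h.symm
          · exact hz (Subtype.ext h ▸ hy)
        refine ⟨ι, inferInstance, σ, Function.update ℓ i (ℓ i + 1), _,
          hc.extend (a := ⟨a, ha⟩) (b := ⟨b, hb⟩) hvu huniq (Function.Embedding.refl ι)
          (fun _ => rfl) ?_ i (j + 1) ?_ ?_ ?_⟩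
        · intro i'
          have := hc.pos i'
          by_cases h : i' = i
          · subst h; simp
          · simpa [h] using this
        · intro i' j'
          by_cases h : i' = i
          · subst h; simp [hj1]; omega
          · simp [h]
        · rintro i' rfl
          exact hj1.le.not_gt
        · intro w
          have : (w : V) = u ↔ w = ⟨u, hu⟩ := by rw [Subtype.ext_iff]
          rw [this, ← hc.injective.eq_iff, hcu]
          rcases hw : c w with y | ⟨i', j'⟩
          · simp
          · have := (hc.mem_range i' j').1 ⟨w, hw⟩
            simp
            grind
    · push Not at hleaf
      have : Nontrivial V := ⟨a, b, hab.ne⟩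
      obtain ⟨u, v, huv, hu, hv⟩ := hT.exists_ne_and_degree_eq_one
      have hab1 : T.degree a = 1 ∧ T.degree b = 1 := by
        have hab' (w) (hw : T.degree w = 1) : w = a ∨ w = b := by
          by_contra! h
          exact hleaf w h.1 h.2 hw
        obtain rfl | rfl := hab' u hu <;> obtain rfl | rfl := hab' v hv <;> simp_all
      obtain ⟨a', ha, ha'⟩ := degree_eq_one_iff_existsUnique_adj.mp hab1.1
      obtain ⟨b', hb, hb'⟩ := degree_eq_one_iff_existsUnique_adj.mp hab1.2
      refine exists_isLegModel_of_subsingleton_compl hab fun w => ?_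
      have hstep (x y) (hxy : T.Adj x y) (hy : y = a ∨ y = b) : x = a ∨ x = b := by
        obtain rfl | rfl := hy
        · exact Or.inr ((ha' x hxy.symm).trans (ha' b hab).symm)
        · exact Or.inl ((hb' x hxy.symm).trans (hb' a hab.symm).symm)
      have hwalk (x y) (p : T.Walk x y) (hy : y = a ∨ y = b) : x = a ∨ x = b := by
        induction p with
        | nil => exact hy
        | cons h p ih => exact hstep _ _ h (ih hy)
      obtain ⟨p⟩ := hT.connected.preconnected w a
      exact hwalk w a p (Or.inl rfl)

end Model

section LegGraph

lemma card_filter_side_add_one {V ι : Type*} [Fintype V] [Fintype ι] {T : SimpleGraph V} {a b : V}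
    [DecidableRel T.Adj] {σ : ι → Bool} {ℓ : ι → ℕ} {c : V → Bool ⊕ ι × ℕ}
    (hc : IsLegModel T a b σ ℓ c) {u v : V} {x : Bool} (hu : c u = .inl x) (hv : c v = .inl !x) :
    (Finset.univ.filter fun i => σ i = x).card + 1 = T.degree u := by
  classical
  choose g hg using fun i => (hc.mem_range i 0).2 (hc.pos i)
  rw [← card_neighborFinset_eq_degree]
  have hinj : Function.Injective g := fun i i' h => by
    have := (hg i).symm.trans (h ▸ hg i')
    simpa using this
  have : T.neighborFinset u = insert v ((Finset.univ.filter fun i => σ i = x).image g) := by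
    ext w
    simp only [mem_neighborFinset, Finset.mem_insert, Finset.mem_image, Finset.mem_filter,
      Finset.mem_univ, true_and]
    rw [hc.adj_iff, hu]
    rcases hw : c w with y | ⟨i, j⟩
    · rw [legGraph_adj_inl_inl, ← hc.injective.eq_iff, hw, hv]
      constructor
      · intro h
        left
        cases x <;> cases y <;> simp_all
      · rintro (h | ⟨i, -, h⟩)
        · cases x <;> cases y <;> simp_all
        · have := hg i
          rw [h, hw] at this
          simp at this
    · rw [legGraph_adj_inl_inr]
      constructor
      · rintro ⟨rfl, h⟩
        exact Or.inr ⟨i, h, hc.injective ((hg i).trans hw.symm)⟩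
      · rintro (rfl | ⟨i', h, h'⟩)
        · simp [hv] at hw
        · have := hg i'
          rw [h', hw] at this
          simp only [Sum.inr.injEq, Prod.mk.injEq] at this
          exact ⟨this.2, this.1 ▸ h⟩
  rw [this, Finset.card_insert_of_notMem, Finset.card_image_of_injective _ hinj]
  simp only [Finset.mem_image, not_exists, not_and]
  rintro i - h
  have := hg i
  rw [h, hv] at this
  simp at this

/-- The coordinates of the two hubs and of the first `ℓ i` vertices of each leg `i`. -/
def legCoord {ι : Type*} (ℓ : ι → ℕ) : (Bool ⊕ Σ i, Fin (ℓ i)) → Bool ⊕ ι × ℕ :=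
  Sum.map id fun p => (p.1, p.2)

lemma legCoord_injective {ι : Type*} (ℓ : ι → ℕ) : Function.Injective (legCoord ℓ) := by
  refine Function.injective_id.sumMap ?_
  rintro ⟨i, j⟩ ⟨i', j'⟩ h
  simp only [Prod.mk.injEq] at h
  obtain ⟨rfl, h⟩ := h
  rw [Fin.ext h]

/-- Two adjacent hubs with legs of lengths `ℓ i`, the leg `i` being attached to the hub `σ i`. -/
def finLegGraph {ι : Type*} (σ : ι → Bool) (ℓ : ι → ℕ) : SimpleGraph (Bool ⊕ Σ i, Fin (ℓ i)) :=
  (legGraph σ).comap (legCoord ℓ)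

theorem IsLegModel.nonempty_iso {V ι : Type*} {T : SimpleGraph V} {a b : V}
    {σ : ι → Bool} {ℓ : ι → ℕ} {c : V → Bool ⊕ ι × ℕ} (hc : IsLegModel T a b σ ℓ c) :
    Nonempty (finLegGraph σ ℓ ≃g T) := by
  have hex (p) : ∃ v, c v = legCoord ℓ p := by
    rcases p with (_ | _) | ⟨i, j⟩
    · exact ⟨b, hc.map_right⟩
    · exact ⟨a, hc.map_left⟩
    · exact (hc.mem_range i j).2 j.2
  choose g hg using hex
  refine ⟨⟨Equiv.ofBijective g ⟨fun p q h => ?_, fun v => ?_⟩, fun {p q} => ?_⟩⟩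
  · exact legCoord_injective ℓ ((hg p).symm.trans (h ▸ hg q))
  · obtain ⟨p, hp⟩ : ∃ p, legCoord ℓ p = c v := by
      rcases hv : c v with x | ⟨i, j⟩
      · exact ⟨.inl x, rfl⟩
      · exact ⟨.inr ⟨i, j, (hc.mem_range i j).1 ⟨v, hv⟩⟩, rfl⟩
    exact ⟨p, hc.injective ((hg p).trans hp)⟩
  · change T.Adj (g p) (g q) ↔ (legGraph σ).Adj (legCoord ℓ p) (legCoord ℓ q)
    rw [hc.adj_iff, hg, hg]

lemma nonempty_finLegGraph_iso_of_equiv {ι ι' : Type*} {σ : ι → Bool} {ℓ : ι → ℕ} {σ' : ι' → Bool}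
    {ℓ' : ι' → ℕ} (e : ι ≃ ι') (hσ : ∀ i, σ' (e i) = σ i) (hℓ : ∀ i, ℓ' (e i) = ℓ i) :
    Nonempty (finLegGraph σ ℓ ≃g finLegGraph σ' ℓ') := by
  obtain rfl : σ = fun i => σ' (e i) := funext fun i => (hσ i).symm
  obtain rfl : ℓ = fun i => ℓ' (e i) := funext fun i => (hℓ i).symm
  refine ⟨⟨(Equiv.refl _).sumCongr (Equiv.sigmaCongrLeft (β := fun i => Fin (ℓ' i)) e), ?_⟩⟩
  rintro (x | ⟨i, j⟩) (y | ⟨i', j'⟩) <;> simp [finLegGraph, legCoord, Equiv.sigmaCongrLeft]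

lemma nonempty_finLegGraph_iso_not {ι : Type*} (σ : ι → Bool) (ℓ : ι → ℕ) :
    Nonempty (finLegGraph σ ℓ ≃g finLegGraph (fun i => !σ i) ℓ) := by
  refine ⟨⟨Equiv.boolNot.sumCongr (Equiv.refl _), ?_⟩⟩
  rintro (x | ⟨i, j⟩) (y | ⟨i', j'⟩) <;> simp [finLegGraph, legCoord]

/-- The lengths of the legs attached to the hub `x`. -/
def sideLengths {ι : Type*} [Fintype ι] (σ : ι → Bool) (ℓ : ι → ℕ) (x : Bool) : Multiset ℕ :=
  (Finset.univ.filter fun i => σ i = x).val.map ℓ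

lemma nonempty_finLegGraph_iso {ι ι' : Type*} [Fintype ι] [Fintype ι'] {σ : ι → Bool} {ℓ : ι → ℕ}
    {σ' : ι' → Bool} {ℓ' : ι' → ℕ} (h : ∀ x, sideLengths σ ℓ x = sideLengths σ' ℓ' x) :
    Nonempty (finLegGraph σ ℓ ≃g finLegGraph σ' ℓ') := by
  classical
  have hcount (p : Bool × ℕ) : Nonempty ({i // (σ i, ℓ i) = p} ≃ {i // (σ' i, ℓ' i) = p}) := by
    refine ⟨Fintype.equivOfCardEq ?_⟩
    have h1 := congrArg (Multiset.count p.2) (h p.1)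
    rw [sideLengths, sideLengths, Multiset.count_map, Multiset.count_map, ← Finset.filter_val,
      ← Finset.filter_val, Finset.filter_filter, Finset.filter_filter] at h1
    rw [Fintype.card_subtype, Fintype.card_subtype]
    convert h1 using 2 <;> simp [Prod.ext_iff, eq_comm, Finset.card_def]
  let e := fun p => (hcount p).some
  have he (i) := Equiv.ofFiberEquiv_map e i
  exact nonempty_finLegGraph_iso_of_equiv (Equiv.ofFiberEquiv e)
    (fun i => congrArg Prod.fst (he i)) (fun i => congrArg Prod.snd (he i))

lemma nonempty_finLegGraph_iso_swap {ι ι' : Type*} [Fintype ι] [Fintype ι'] {σ : ι → Bool}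
    {ℓ : ι → ℕ} {σ' : ι' → Bool} {ℓ' : ι' → ℕ}
    (h : ∀ x, sideLengths σ ℓ x = sideLengths σ' ℓ' !x) :
    Nonempty (finLegGraph σ ℓ ≃g finLegGraph σ' ℓ') := by
  obtain ⟨f⟩ := nonempty_finLegGraph_iso_not σ' ℓ'
  obtain ⟨g⟩ : Nonempty (finLegGraph σ ℓ ≃g finLegGraph (fun i => !σ' i) ℓ') := by
    refine nonempty_finLegGraph_iso fun x => ?_
    rw [h, sideLengths, sideLengths]
    congr! 3
    cases x <;> simp
  exact ⟨g.trans f.symm⟩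

end LegGraph

section LegSum

open Polynomial

/-- The color sum of a path with `n` vertices hanging from a vertex of color `c`. -/
def legSum {κ R : Type*} [Fintype κ] [CommRing R] (y : κ → R) : ℕ → κ → R
  | 0, _ => 1
  | n + 1, c => ∑ c', y c' * legSum y n c' - y c * legSum y n c

/-- A coloring of a path with `n` vertices which is proper and remains so when the path hangs from
a vertex of color `c`. -/
def IsLegColoring {κ : Type*} {n : ℕ} (c : κ) (w : Fin n → κ) : Prop :=
  ∀ j, w j ≠ (Fin.cons c w : Fin (n + 1) → κ) j.castSucc

lemma isLegColoring_cons {κ : Type*} {n : ℕ} (c c' : κ) (w : Fin n → κ) :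
    IsLegColoring c (Fin.cons c' w : Fin (n + 1) → κ) ↔ c' ≠ c ∧ IsLegColoring c' w := by
  rw [IsLegColoring, Fin.forall_fin_succ]
  refine and_congr (by simp) (forall_congr' fun j => ?_)
  rw [Fin.cons_succ, ← Fin.succ_castSucc, Fin.cons_succ]

open Classical in
lemma sum_isLegColoring {κ R : Type*} [Fintype κ] [CommRing R] (y : κ → R) (n : ℕ) (c : κ) :
    ∑ w : Fin n → κ, (if IsLegColoring c w then ∏ j, y (w j) else 0) = legSum y n c := by
  induction n generalizing c with
  | zero => simp [legSum, IsLegColoring]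
  | succ n ih =>
    rw [← (Fin.consEquiv fun _ : Fin (n + 1) => κ).sum_comp, Fintype.sum_prod_type, legSum,
      eq_sub_iff_add_eq, ← Finset.sum_erase_add _ _ (Finset.mem_univ c),
      ← Finset.sum_erase_add _ (fun c' => y c' * legSum y n c') (Finset.mem_univ c)]
    congr 1
    rw [add_eq_left.2]
    · refine Finset.sum_congr rfl fun c' hc' => ?_
      rw [← ih, Finset.mul_sum]
      refine Finset.sum_congr rfl fun w _ => ?_
      have hw : IsLegColoring c ((Fin.consEquiv fun _ : Fin (n + 1) => κ) (c', w)) ↔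
          IsLegColoring c' w :=
        (isLegColoring_cons c c' w).trans (and_iff_right (Finset.mem_erase.1 hc').1)
      simp only [hw, Fin.consEquiv_apply, Fin.prod_univ_succ, Fin.cons_zero, Fin.cons_succ,
        mul_ite, mul_zero]
    · refine Finset.sum_eq_zero fun w _ => if_neg fun hw => ?_
      exact ((isLegColoring_cons c c w).1 hw).1 rfl

lemma forall_adj_finLegGraph_iff {ι κ : Type*} {σ : ι → Bool} {ℓ : ι → ℕ}
    (k : (Bool ⊕ Σ i, Fin (ℓ i)) → κ) :
    (∀ u v, (finLegGraph σ ℓ).Adj u v → k u ≠ k v) ↔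
      k (.inl true) ≠ k (.inl false) ∧
        ∀ i, IsLegColoring (k (.inl (σ i))) fun j => k (.inr ⟨i, j⟩) := by
  constructor
  · refine fun h => ⟨h _ _ (by simp [finLegGraph, legCoord]), fun i j => ?_⟩
    have hpar (j' : Fin (ℓ i + 1)) (hj' : j' = j.castSucc) : k (.inr ⟨i, j⟩) ≠
        (Fin.cons (k (.inl (σ i))) fun j => k (.inr ⟨i, j⟩) : Fin (ℓ i + 1) → κ) j' := by
      induction j' using Fin.cases with
      | zero =>
        have : (j : ℕ) = 0 := by simpa using (congrArg Fin.val hj').symm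
        exact h _ _ (by simp [finLegGraph, legCoord, this])
      | succ j' =>
        have : (j' : ℕ) + 1 = j := by simpa using (congrArg Fin.val hj')
        exact h _ _ (by simp [finLegGraph, legCoord, ← this])
    exact hpar _ rfl
  · rintro ⟨h0, h⟩
    have hzero (i) (j : Fin (ℓ i)) (hj : (j : ℕ) = 0) : k (.inr ⟨i, j⟩) ≠ k (.inl (σ i)) := by
      have := h i j
      rwa [show j.castSucc = 0 from Fin.ext hj, Fin.cons_zero] at this
    have hsucc (i) (j j' : Fin (ℓ i)) (hj : (j : ℕ) = j' + 1) :
        k (.inr ⟨i, j⟩) ≠ k (.inr ⟨i, j'⟩) := by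
      have := h i j
      rwa [show j.castSucc = j'.succ from Fin.ext (by simpa using hj), Fin.cons_succ] at this
    rintro (x | ⟨i, j⟩) (x' | ⟨i', j'⟩) hadj <;>
      simp only [finLegGraph, legCoord, comap_adj, Sum.map_inl, Sum.map_inr, id_eq,
        legGraph_adj_inl_inl, legGraph_adj_inl_inr, legGraph_adj_inr_inl,
        legGraph_adj_inr_inr] at hadj
    · cases x <;> cases x' <;> simp_all [eq_comm]
    · exact hadj.2 ▸ (hzero _ _ hadj.1).symm
    · exact hadj.2 ▸ hzero _ _ hadj.1
    · obtain ⟨rfl, hj | hj⟩ := hadj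
      · exact hsucc _ _ _ hj
      · exact (hsucc _ _ _ hj).symm

/-- A coloring of a leg graph consists of the colors of the hubs and colorings of the legs. -/
def legColoringEquiv {ι : Type*} (κ : Type*) (ℓ : ι → ℕ) :
    (κ × κ) × (∀ i, Fin (ℓ i) → κ) ≃ ((Bool ⊕ Σ i, Fin (ℓ i)) → κ) where
  toFun p := Sum.elim (fun x => if x then p.1.1 else p.1.2) fun s => p.2 s.1 s.2
  invFun k := ((k (.inl true), k (.inl false)), fun i j => k (.inr ⟨i, j⟩))
  left_inv p := by simp
  right_inv k := by
    funext s
    rcases s with (_ | _) | ⟨i, j⟩ <;> simp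

lemma prod_legColoringEquiv {ι κ R : Type*} [Fintype ι] [CommRing R] (ℓ : ι → ℕ) (y : κ → R)
    (p : (κ × κ) × (∀ i, Fin (ℓ i) → κ)) :
    ∏ v, y (legColoringEquiv κ ℓ p v) = y p.1.1 * y p.1.2 * ∏ i, ∏ j, y (p.2 i j) := by
  rw [Fintype.prod_sum_type, Fintype.prod_sigma, Fintype.prod_bool]
  rfl

lemma forall_adj_legColoringEquiv_iff {ι κ : Type*} (σ : ι → Bool) (ℓ : ι → ℕ)
    (p : (κ × κ) × (∀ i, Fin (ℓ i) → κ)) :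
    (∀ u v, (finLegGraph σ ℓ).Adj u v → legColoringEquiv κ ℓ p u ≠ legColoringEquiv κ ℓ p v) ↔
      p.1.1 ≠ p.1.2 ∧ ∀ i, IsLegColoring (if σ i then p.1.1 else p.1.2) (p.2 i) :=
  forall_adj_finLegGraph_iff _

lemma colorSum_finLegGraph {ι κ R : Type*} [Fintype ι] [Fintype κ] [CommRing R] (σ : ι → Bool)
    (ℓ : ι → ℕ) (y : κ → R) [DecidableEq κ] :
    colorSum (finLegGraph σ ℓ) y = ∑ c, ∑ c', if c ≠ c' then
      (y c * ((sideLengths σ ℓ true).map fun n => legSum y n c).prod) *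
        (y c' * ((sideLengths σ ℓ false).map fun n => legSum y n c').prod) else 0 := by
  classical
  have hsplit (c c' : κ) : ∏ i, legSum y (ℓ i) (if σ i then c else c') =
      ((sideLengths σ ℓ true).map fun n => legSum y n c).prod *
        ((sideLengths σ ℓ false).map fun n => legSum y n c').prod := by
    rw [← Finset.prod_filter_mul_prod_filter_not _ fun i => σ i = true]
    rw [sideLengths, sideLengths, Multiset.map_map, Multiset.map_map]
    congr 1
    · refine Finset.prod_congr rfl fun i hi => ?_
      simp [(Finset.mem_filter.1 hi).2]
    · simp only [Bool.not_eq_true]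
      refine Finset.prod_congr rfl fun i hi => ?_
      simp [(Finset.mem_filter.1 hi).2]
  have hE {I : Fintype ((Bool ⊕ Σ i, Fin (ℓ i)) → κ)} (f : ((Bool ⊕ Σ i, Fin (ℓ i)) → κ) → R) :
      ∑ k, f k = ∑ p, f (legColoringEquiv κ ℓ p) :=
    (Fintype.sum_equiv (legColoringEquiv κ ℓ) _ _ fun _ => rfl).symm
  rw [colorSum, hE, Fintype.sum_prod_type, Fintype.sum_prod_type]
  refine Finset.sum_congr rfl fun c _ => Finset.sum_congr rfl fun c' _ => ?_
  simp only [prod_legColoringEquiv]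
  by_cases hcc : c = c'
  · rw [if_neg (not_not.2 hcc)]
    exact Finset.sum_eq_zero fun w _ =>
      if_neg fun h => ((forall_adj_legColoringEquiv_iff σ ℓ _).1 h).1 hcc
  rw [if_pos hcc, mul_mul_mul_comm, ← hsplit]
  simp only [← sum_isLegColoring]
  rw [Finset.prod_univ_sum, Finset.mul_sum, Fintype.piFinset_univ]
  refine Finset.sum_congr rfl fun w _ => ?_
  rw [Finset.prod_ite_zero, mul_ite, mul_zero]
  have h := forall_adj_legColoringEquiv_iff σ ℓ ((c, c'), w)
  rw [and_iff_right hcc] at h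
  by_cases hw : ∀ i, IsLegColoring (if σ i then c else c') (w i)
  · rw [if_pos (h.2 hw), if_pos fun i _ => hw i]
  · rw [if_neg (mt h.1 hw), if_neg fun h' => hw fun i => h' i (Finset.mem_univ i)]

end LegSum

section LegPoly

open Polynomial

/-- The values of `legSum` for `specialWeight q m t` at a special and at an ordinary color, as
polynomials in the number `m` of special colors. -/
noncomputable def legPoly {R : Type*} [CommRing R] (q t : R) : ℕ → R[X] × R[X]
  | 0 => (1, 1)
  | n + 1 =>
    (X * C q * (legPoly q t n).1 + C t * (legPoly q t n).2 - C q * (legPoly q t n).1,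
      X * C q * (legPoly q t n).1 + C t * (legPoly q t n).2 - (legPoly q t n).2)

lemma legSum_specialWeight {R : Type*} [CommRing R] (q : R) (m t n : ℕ) (c : Fin m ⊕ Fin t) :
    legSum (specialWeight q m t) n c = Sum.elim (fun _ => (legPoly q t n).1.eval (m : R))
      (fun _ => (legPoly q t n).2.eval (m : R)) c := by
  induction n generalizing c with
  | zero => cases c <;> simp [legSum, legPoly]
  | succ n ih =>
    rw [legSum, Fintype.sum_sum_type]
    simp only [ih]
    cases c <;> simp [legPoly, specialWeight] <;> ring

lemma specialPoly_finLegGraph {ι R : Type*} [Fintype ι] [CommRing R] [IsDomain R] [CharZero R]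
    (σ : ι → Bool) (ℓ : ι → ℕ) (q : R) (t : ℕ) :
    specialPoly (finLegGraph σ ℓ) q t =
      (X * C q * ((sideLengths σ ℓ true).map fun n => (legPoly q t n).1).prod +
          C (t : R) * ((sideLengths σ ℓ true).map fun n => (legPoly q t n).2).prod) *
        (X * C q * ((sideLengths σ ℓ false).map fun n => (legPoly q t n).1).prod +
          C (t : R) * ((sideLengths σ ℓ false).map fun n => (legPoly q t n).2).prod) -
      (X * C q ^ 2 * (((sideLengths σ ℓ true) + (sideLengths σ ℓ false)).map
          fun n => (legPoly q t n).1).prod +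
        C (t : R) * (((sideLengths σ ℓ true) + (sideLengths σ ℓ false)).map
          fun n => (legPoly q t n).2).prod) := by
  classical
  refine eq_of_eval_natCast_eq fun m => ?_
  have hsum (f g : Fin m ⊕ Fin t → R) : ∑ c, ∑ c', (if c ≠ c' then f c * g c' else 0) =
      (∑ c, f c) * (∑ c, g c) - ∑ c, f c * g c := by
    rw [Finset.sum_mul_sum, ← Finset.sum_sub_distrib]
    refine Finset.sum_congr rfl fun c _ => ?_
    simp only [ne_eq, ite_not]
    rw [eq_sub_iff_add_eq, ← Finset.sum_erase_add _ _ (Finset.mem_univ c), if_pos rfl, add_zero,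
      ← Finset.sum_erase_add _ (fun c' => f c * g c') (Finset.mem_univ c)]
    congr 1
    exact Finset.sum_congr rfl fun c' hc' => if_neg (Finset.mem_erase.1 hc').1.symm
  rw [eval_specialPoly, colorSum_finLegGraph, hsum]
  simp only [legSum_specialWeight]
  simp only [Fintype.sum_sum_type, Sum.elim_inl, Sum.elim_inr, specialWeight,
    Finset.sum_const, Finset.card_univ, Fintype.card_fin, nsmul_eq_mul, eval_sub, eval_add,
    eval_mul, eval_X, eval_C, eval_pow, Multiset.map_add, Multiset.prod_add, eval_multiset_prod,
    Multiset.map_map, Function.comp_def]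
  ring

/-- The normalized constant coefficient of `legPoly` at the special color. -/
def legRatio {R : Type*} [CommRing R] (Q θ : R) : ℕ → R
  | 0 => 1
  | n + 1 => θ + Q * legRatio Q θ n

lemma map_legRatio {R S : Type*} [CommRing R] [CommRing S] (f : R →+* S) (Q θ : R) (n : ℕ) :
    f (legRatio Q θ n) = legRatio (f Q) (f θ) n := by
  induction n with
  | zero => simp [legRatio]
  | succ n ih => simp [legRatio, ih]

lemma coeff_legPoly {R : Type*} [CommRing R] (τ θ Q : R) (hτ : τ * θ = τ + 1) (n : ℕ) :
    (legPoly (-(τ * Q)) (τ * θ) n).1.coeff 0 = τ ^ n * legRatio Q θ n ∧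
    (legPoly (-(τ * Q)) (τ * θ) n).2.coeff 0 = τ ^ n ∧
    (legPoly (-(τ * Q)) (τ * θ) n).2.coeff 1 =
      -(τ ^ n * Q * ∑ i ∈ Finset.range n, legRatio Q θ i) := by
  induction n with
  | zero => simp [legPoly, legRatio, coeff_one]
  | succ n ih =>
    obtain ⟨h1, h2, h3⟩ := ih
    simp only [legPoly, coeff_sub, coeff_add, mul_assoc X, coeff_X_mul_zero, coeff_C_mul, h1, h2,
      coeff_X_mul, h3, legRatio, Finset.sum_range_succ]
    refine ⟨by ring, by linear_combination τ ^ n * hτ, ?_⟩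
    linear_combination (-(τ ^ n * Q * ∑ i ∈ Finset.range n, legRatio Q θ i)) * hτ

lemma coeff_prod_legPoly {R : Type*} [CommRing R] (τ θ Q : R) (hτ : τ * θ = τ + 1)
    (s : Multiset ℕ) :
    (s.map fun n => (legPoly (-(τ * Q)) (τ * θ) n).1).prod.coeff 0 =
      τ ^ s.sum * (s.map (legRatio Q θ)).prod ∧
    (s.map fun n => (legPoly (-(τ * Q)) (τ * θ) n).2).prod.coeff 0 = τ ^ s.sum ∧
    (s.map fun n => (legPoly (-(τ * Q)) (τ * θ) n).2).prod.coeff 1 =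
      -(τ ^ s.sum * Q * (s.map fun n => ∑ i ∈ Finset.range n, legRatio Q θ i).sum) := by
  induction s using Multiset.induction_on with
  | empty => simp [coeff_one]
  | cons n s ih =>
    obtain ⟨h1, h2, h3⟩ := ih
    obtain ⟨h4, h5, h6⟩ := coeff_legPoly τ θ Q hτ n
    simp only [Multiset.map_cons, Multiset.prod_cons, Multiset.sum_cons, mul_coeff_zero,
      mul_coeff_one, h1, h2, h3, h4, h5, h6]
    refine ⟨by ring, by ring, by ring⟩

/-- Up to a factor depending only on the order, the linear coefficient of `specialPoly` for two
adjacent hubs with legs of lengths `A` and `B`. -/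
def legInvariant {R : Type*} [CommRing R] (Q θ : R) (A B : Multiset ℕ) : R :=
  Q * (A.map (legRatio Q θ)).prod * (B.map (legRatio Q θ)).prod +
    θ * ((A.map (legRatio Q θ)).prod + (B.map (legRatio Q θ)).prod) +
      θ * ((A + B).map fun n => ∑ i ∈ Finset.range n, legRatio Q θ i).sum

lemma map_legInvariant {R S : Type*} [CommRing R] [CommRing S] (f : R →+* S) (Q θ : R)
    (A B : Multiset ℕ) : f (legInvariant Q θ A B) = legInvariant (f Q) (f θ) A B := by
  simp [legInvariant, map_multiset_prod, map_multiset_sum, Multiset.map_map, map_legRatio]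

lemma coeff_one_specialPoly_finLegGraph {ι R : Type*} [Fintype ι] [CommRing R] [IsDomain R]
    [CharZero R] (σ : ι → Bool) (ℓ : ι → ℕ) {τ θ : R} (Q : R) {t : ℕ} (hτ : τ * θ = τ + 1)
    (ht : τ * θ = t) :
    (specialPoly (finLegGraph σ ℓ) (-(τ * Q)) t).coeff 1 =
      -(τ ^ ((sideLengths σ ℓ true + sideLengths σ ℓ false).sum + 2) * Q *
        legInvariant Q θ (sideLengths σ ℓ true) (sideLengths σ ℓ false)) := by
  rw [specialPoly_finLegGraph, ← ht]
  set A := sideLengths σ ℓ true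
  set B := sideLengths σ ℓ false
  obtain ⟨h1, h2, h3⟩ := coeff_prod_legPoly τ θ Q hτ A
  obtain ⟨h4, h5, h6⟩ := coeff_prod_legPoly τ θ Q hτ B
  simp only [Multiset.map_add, Multiset.prod_add, coeff_sub, coeff_add, mul_coeff_one, ← C_pow,
    coeff_C_zero, coeff_C_of_ne_zero one_ne_zero,
    mul_coeff_zero, coeff_X_zero, coeff_X_one, h1, h2, h3, h4, h5, h6, legInvariant,
    Multiset.sum_add]
  set s := (A.map fun n => ∑ i ∈ Finset.range n, legRatio Q θ i).sum
  set s' := (B.map fun n => ∑ i ∈ Finset.range n, legRatio Q θ i).sum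
  set p := (A.map (legRatio Q θ)).prod
  set p' := (B.map (legRatio Q θ)).prod
  linear_combination (-(τ ^ (A.sum + B.sum) * Q * (s + s') * τ * θ)) * hτ

end LegPoly

section Recovery

open Polynomial

lemma mem_of_prod_one_sub_X_pow_eq {s s' : Multiset ℕ} (hs' : ∀ n ∈ s', 0 < n) {m : ℕ}
    (hm : m ∈ s) (hm0 : 0 < m) (hmax : ∀ n ∈ s', n ≤ m)
    (h : (s.map fun n => 1 - (X : ℂ[X]) ^ n).prod = (s'.map fun n => 1 - (X : ℂ[X]) ^ n).prod) :
    m ∈ s' := by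
  have hζ := Complex.isPrimitiveRoot_exp m hm0.ne'
  set ζ := Complex.exp (2 * Real.pi * Complex.I / m)
  have h1 := congrArg (eval ζ) h
  rw [eval_multiset_prod, eval_multiset_prod, Multiset.map_map, Multiset.map_map,
    Multiset.prod_eq_zero (Multiset.mem_map.2 ⟨m, hm, by simp [hζ.pow_eq_one]⟩)] at h1
  obtain ⟨n, hn, hn0⟩ := Multiset.mem_map.1 (Multiset.prod_eq_zero_iff.1 h1.symm)
  have : ζ ^ n = 1 := by
    simp only [Function.comp_apply, eval_sub, eval_one, eval_pow, eval_X] at hn0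
    exact (sub_eq_zero.1 hn0).symm
  rwa [(hmax n hn).antisymm (Nat.le_of_dvd (hs' n hn) (hζ.dvd_of_pow_eq_one n this))] at hn

lemma eq_of_prod_one_sub_X_pow_eq {s s' : Multiset ℕ} (hs : ∀ n ∈ s, 0 < n)
    (hs' : ∀ n ∈ s', 0 < n) (hcard : s.card = s'.card)
    (h : (s.map fun n => 1 - (X : ℂ[X]) ^ n).prod = (s'.map fun n => 1 - (X : ℂ[X]) ^ n).prod) :
    s = s' := by
  induction hk : s.card generalizing s s' with
  | zero => rw [Multiset.card_eq_zero.1 hk, eq_comm, ← Multiset.card_eq_zero, ← hcard, hk]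
  | succ k ih =>
    obtain ⟨m, hm, hmax⟩ := (s + s').toFinset.exists_max_image id (by
      obtain ⟨n, hn⟩ := Multiset.card_pos_iff_exists_mem.1 (hk.symm ▸ Nat.succ_pos k : 0 < s.card)
      exact ⟨n, by simp [hn]⟩)
    simp only [Multiset.toFinset_add, Finset.mem_union, Multiset.mem_toFinset, id] at hm hmax
    have hmem : m ∈ s ∧ m ∈ s' := by
      rcases hm with hm | hm
      · exact ⟨hm, mem_of_prod_one_sub_X_pow_eq hs' hm (hs m hm) (fun n hn => hmax n (.inr hn)) h⟩
      · exact ⟨mem_of_prod_one_sub_X_pow_eq hs hm (hs' m hm) (fun n hn => hmax n (.inl hn)) h.symm,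
          hm⟩
    obtain ⟨t, rfl⟩ := Multiset.exists_cons_of_mem hmem.1
    obtain ⟨t', rfl⟩ := Multiset.exists_cons_of_mem hmem.2
    have hne : 1 - (X : ℂ[X]) ^ m ≠ 0 := by
      rw [sub_ne_zero]
      intro h
      have := congrArg natDegree h
      rw [natDegree_one, natDegree_X_pow] at this
      exact (hs m hmem.1).ne this
    simp only [Multiset.card_cons, Nat.add_right_cancel_iff] at hk hcard
    simp only [Multiset.map_cons, Multiset.prod_cons] at h
    rw [ih (fun n hn => hs n (Multiset.mem_cons_of_mem hn))
      (fun n hn => hs' n (Multiset.mem_cons_of_mem hn)) hcard (mul_left_cancel₀ hne h) hk]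

lemma eq_of_prod_geom_sum_eq {s s' : Multiset ℕ} (hs : ∀ n ∈ s, 0 < n)
    (hs' : ∀ n ∈ s', 0 < n) (hcard : s.card = s'.card)
    (h : (s.map fun n => ∑ i ∈ Finset.range n, (X : ℂ[X]) ^ i).prod =
      (s'.map fun n => ∑ i ∈ Finset.range n, (X : ℂ[X]) ^ i).prod) : s = s' := by
  refine eq_of_prod_one_sub_X_pow_eq hs hs' hcard ?_
  have key (t : Multiset ℕ) : (t.map fun n => 1 - (X : ℂ[X]) ^ n).prod =
      (t.map fun n => ∑ i ∈ Finset.range n, (X : ℂ[X]) ^ i).prod * (1 - X) ^ t.card := by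
    rw [← Multiset.prod_replicate, ← Multiset.map_const', ← Multiset.prod_map_mul]
    simp only [geom_sum_mul_neg]
  rw [key, key, h, hcard]

lemma natDegree_legRatio_le {R : Type*} [CommRing R] (Q : R) (n : ℕ) :
    (legRatio (C Q) X n).natDegree ≤ 1 := by
  induction n with
  | zero => simp [legRatio]
  | succ n ih =>
    rw [legRatio]
    exact natDegree_add_le_of_degree_le natDegree_X_le ((natDegree_C_mul_le _ _).trans ih)

lemma coeff_one_legRatio {R : Type*} [CommRing R] (Q : R) (n : ℕ) :
    (legRatio (C Q) X n).coeff 1 = ∑ i ∈ Finset.range n, Q ^ i := by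
  induction n with
  | zero => simp [legRatio, coeff_one]
  | succ n ih => rw [legRatio, coeff_add, coeff_X_one, coeff_C_mul, ih, geom_sum_succ, add_comm]

lemma natDegree_prod_legRatio_le {R : Type*} [CommRing R] (Q : R) (s : Multiset ℕ) :
    (s.map (legRatio (C Q) X)).prod.natDegree ≤ s.card := by
  refine (natDegree_multiset_prod_le _).trans ?_
  refine (Multiset.sum_le_card_nsmul _ 1 fun d hd => ?_).trans (by simp)
  simp only [Multiset.map_map, Multiset.mem_map] at hd
  obtain ⟨n, -, rfl⟩ := hd
  exact natDegree_legRatio_le Q n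

lemma coeff_card_prod_legRatio {R : Type*} [CommRing R] (Q : R) (s : Multiset ℕ) :
    (s.map (legRatio (C Q) X)).prod.coeff s.card =
      (s.map fun n => ∑ i ∈ Finset.range n, Q ^ i).prod := by
  have := coeff_multiset_prod_of_natDegree_le (s.map (legRatio (C Q) X)) 1 fun p hp => by
    obtain ⟨n, -, rfl⟩ := Multiset.mem_map.1 hp
    exact natDegree_legRatio_le Q n
  rw [Multiset.card_map, mul_one, Multiset.map_map] at this
  rw [this]
  simp only [Function.comp_def, coeff_one_legRatio]

lemma geom_sum_X_ne_zero {n : ℕ} (hn : 0 < n) : ∑ i ∈ Finset.range n, (X : ℂ[X]) ^ i ≠ 0 := by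
  intro h
  have := congrArg (eval 1) h
  simp [eval_finsetSum, hn.ne'] at this

lemma natDegree_prod_legRatio {s : Multiset ℕ} (hs : ∀ n ∈ s, 0 < n) :
    (s.map (legRatio (C (X : ℂ[X])) X)).prod.natDegree = s.card := by
  refine natDegree_eq_of_le_of_coeff_ne_zero (natDegree_prod_legRatio_le _ s) ?_
  rw [coeff_card_prod_legRatio]
  refine Multiset.prod_ne_zero fun h => ?_
  obtain ⟨n, hn, h0⟩ := Multiset.mem_map.1 h
  exact geom_sum_X_ne_zero (hs n hn) h0

lemma eq_of_prod_legRatio_eq {s s' : Multiset ℕ} (hs : ∀ n ∈ s, 0 < n) (hs' : ∀ n ∈ s', 0 < n)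
    (h : (s.map (legRatio (C (X : ℂ[X])) X)).prod = (s'.map (legRatio (C (X : ℂ[X])) X)).prod) :
    s = s' := by
  have hcard : s.card = s'.card := by
    rw [← natDegree_prod_legRatio hs, h, natDegree_prod_legRatio hs']
  refine eq_of_prod_geom_sum_eq hs hs' hcard ?_
  rw [← coeff_card_prod_legRatio, ← coeff_card_prod_legRatio, h, hcard]

lemma coeff_legInvariant {R : Type*} [CommRing R] (Q : R) {A B : Multiset ℕ} (hA : 2 ≤ A.card)
    (hB : 2 ≤ B.card) : (legInvariant (C Q) X A B).coeff (A.card + B.card) =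
      Q * ((A + B).map fun n => ∑ i ∈ Finset.range n, Q ^ i).prod := by
  have h1 : (X * ((A.map (legRatio (C Q) X)).prod + (B.map (legRatio (C Q) X)).prod)).coeff
      (A.card + B.card) = 0 := by
    rw [show A.card + B.card = (A.card + B.card - 1) + 1 by omega, coeff_X_mul, coeff_add,
      coeff_eq_zero_of_natDegree_lt, coeff_eq_zero_of_natDegree_lt, add_zero]
    · exact (natDegree_prod_legRatio_le Q B).trans_lt (by omega)
    · exact (natDegree_prod_legRatio_le Q A).trans_lt (by omega)
  have h2 : (X * ((A + B).map fun n => ∑ i ∈ Finset.range n, legRatio (C Q) X i).sum).coeff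
      (A.card + B.card) = 0 := by
    rw [show A.card + B.card = (A.card + B.card - 1) + 1 by omega, coeff_X_mul]
    refine coeff_eq_zero_of_natDegree_lt (lt_of_le_of_lt ?_ (show 1 < _ by omega))
    generalize A + B = s
    induction s using Multiset.induction_on with
    | empty => simp
    | cons n s ih =>
      rw [Multiset.map_cons, Multiset.sum_cons]
      exact natDegree_add_le_of_degree_le
        (natDegree_sum_le_of_forall_le _ _ fun i _ => natDegree_legRatio_le Q i) ih
  rw [legInvariant, coeff_add, coeff_add, h1, h2, add_zero, add_zero, mul_assoc, coeff_C_mul,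
    ← Multiset.prod_add, ← Multiset.map_add, ← Multiset.card_add, coeff_card_prod_legRatio]

theorem eq_of_legInvariant_eq {A B A' B' : Multiset ℕ} (hA : 2 ≤ A.card) (hB : 2 ≤ B.card)
    (hA' : 2 ≤ A'.card) (hB' : 2 ≤ B'.card) (hcard : A.card + B.card = A'.card + B'.card)
    (hpos : ∀ n ∈ A + B, 0 < n) (hpos' : ∀ n ∈ A' + B', 0 < n)
    (h : legInvariant (C (X : ℂ[X])) X A B = legInvariant (C (X : ℂ[X])) X A' B') :
    (A = A' ∧ B = B') ∨ (A = B' ∧ B = A') := by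
  have hsum : A + B = A' + B' := by
    refine eq_of_prod_geom_sum_eq hpos hpos' (by simpa using hcard) ?_
    have h1 := congrArg (coeff · (A.card + B.card)) h
    simp only [coeff_legInvariant X hA hB] at h1
    rw [hcard, coeff_legInvariant X hA' hB'] at h1
    exact mul_left_cancel₀ X_ne_zero h1
  obtain ⟨P, hP⟩ : ∃ P : Multiset ℕ → ℂ[X][X],
      ∀ s, (s.map (legRatio (C (X : ℂ[X])) X)).prod = P s := ⟨_, fun _ => rfl⟩
  have hPadd (s t) : P (s + t) = P s * P t := by simp [← hP]
  have hprod : P A * P B = P A' * P B' := by rw [← hPadd, hsum, hPadd]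
  have hadd : P A + P B = P A' + P B' := by
    rw [legInvariant, legInvariant] at h
    simp only [hP] at h
    rw [hsum, mul_assoc, mul_assoc, hprod] at h
    exact mul_left_cancel₀ X_ne_zero (add_left_cancel (add_right_cancel h))
  have hzero : (P A - P A') * (P A - P B') = 0 := by
    linear_combination P A * hadd - hprod
  have hposA (n) (hn : n ∈ A) : 0 < n := hpos n (Multiset.mem_add.2 (.inl hn))
  have hposA' (n) (hn : n ∈ A') : 0 < n := hpos' n (Multiset.mem_add.2 (.inl hn))
  have hposB' (n) (hn : n ∈ B') : 0 < n := hpos' n (Multiset.mem_add.2 (.inr hn))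
  rcases mul_eq_zero.1 hzero with h0 | h0
  · obtain rfl := eq_of_prod_legRatio_eq hposA hposA'
      (by rw [hP, hP, sub_eq_zero.1 h0])
    exact .inl ⟨rfl, add_left_cancel hsum⟩
  · obtain rfl := eq_of_prod_legRatio_eq hposA hposB'
      (by rw [hP, hP, sub_eq_zero.1 h0])
    exact .inr ⟨rfl, add_left_cancel (hsum.trans (add_comm _ _))⟩

end Recovery

section Reconstruction

open Polynomial

lemma specialPoly_congr {V W R : Type*} [Fintype V] [Fintype W] [CommRing R] [IsDomain R]
    [CharZero R] {G : SimpleGraph V} {H : SimpleGraph W} (f : G ≃g H) (q : R) (t : ℕ) :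
    specialPoly G q t = specialPoly H q t :=
  eq_of_eval_natCast_eq fun m => by
    rw [eval_specialPoly, eval_specialPoly, colorSum_congr f (Equiv.refl _), Equiv.coe_refl,
      Function.comp_id]

lemma sideLengths_add {ι : Type*} [Fintype ι] (σ : ι → Bool) (ℓ : ι → ℕ) :
    sideLengths σ ℓ true + sideLengths σ ℓ false = Finset.univ.val.map ℓ := by
  rw [sideLengths, sideLengths, ← Multiset.map_add, Finset.filter_val, Finset.filter_val]
  simp only [← Bool.not_eq_true]
  rw [Multiset.filter_add_not]

lemma sum_sideLengths_add {V ι : Type*} [Fintype V] [Fintype ι] {T : SimpleGraph V} {σ : ι → Bool}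
    {ℓ : ι → ℕ} (f : finLegGraph σ ℓ ≃g T) :
    (sideLengths σ ℓ true + sideLengths σ ℓ false).sum + 2 = Fintype.card V := by
  rw [← Fintype.card_congr f.toEquiv, Fintype.card_sum, Fintype.card_sigma, sideLengths_add,
    Fintype.card_bool, add_comm]
  simp

lemma legInvariant_eq_of_csf_eq {V W ι ι' : Type*} [Fintype V] [Fintype W] [Fintype ι] [Fintype ι']
    {F : SimpleGraph W} {T : SimpleGraph V} (h : csf F = csf T) {σ : ι → Bool} {ℓ : ι → ℕ}
    {σ' : ι' → Bool} {ℓ' : ι' → ℕ} (f : finLegGraph σ ℓ ≃g F) (g : finLegGraph σ' ℓ' ≃g T) :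
    legInvariant (C (X : ℂ[X])) X (sideLengths σ ℓ true) (sideLengths σ ℓ false) =
      legInvariant (C (X : ℂ[X])) X (sideLengths σ' ℓ' true) (sideLengths σ' ℓ' false) := by
  refine eq_of_eval_ratio_eq fun t ht => ?_
  simp only [← coe_evalRingHom, map_legInvariant]
  simp only [coe_evalRingHom, eval_C, eval_X]
  set τ : ℂ[X] := algebraMap ℚ ℂ[X] (t - 1) with hτdef
  set θ : ℂ[X] := algebraMap ℚ ℂ[X] (t / (t - 1))
  have ht1 : (t : ℚ) - 1 ≠ 0 := by
    have : (2 : ℚ) ≤ t := by exact_mod_cast ht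
    linarith
  have hτ0 : τ ≠ 0 := (map_ne_zero_iff _ (algebraMap ℚ ℂ[X]).injective).2 ht1
  have hτt : τ * θ = t := by
    rw [← map_mul, mul_div_cancel₀ _ ht1, map_natCast]
  have hτ1 : τ * θ = τ + 1 := by
    rw [hτt, hτdef, map_sub, map_natCast, map_one, sub_add_cancel]
  have h1 := congrArg (coeff · 1) (specialPoly_eq h (-(τ * X)) t)
  simp only [← specialPoly_congr f, ← specialPoly_congr g,
    coeff_one_specialPoly_finLegGraph _ _ X hτ1 hτt, sum_sideLengths_add f,
    sum_sideLengths_add g, card_eq_of_csf_eq h] at h1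
  exact mul_left_cancel₀ (mul_ne_zero (pow_ne_zero _ hτ0) X_ne_zero) (neg_injective h1)

open Classical in
/-- A tree with exactly two vertices of degree at least 3, adjacent to each other, consists of two
hubs and their legs. -/
lemma exists_finLegGraph_iso {V : Type*} [Fintype V] {T : SimpleGraph V} (hT : T.IsTree) {a b : V}
    (hab : T.Adj a b) (hbig : ∀ v, 3 ≤ T.degree v ↔ v = a ∨ v = b) :
    ∃ (ι : Type) (_ : Fintype ι) (σ : ι → Bool) (ℓ : ι → ℕ), Nonempty (finLegGraph σ ℓ ≃g T) ∧
      (∀ i, 0 < ℓ i) ∧ (sideLengths σ ℓ true).card + 1 = T.degree a ∧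
        (sideLengths σ ℓ false).card + 1 = T.degree b := by
  obtain ⟨ι, _, σ, ℓ, c, hc⟩ := exists_isLegModel hT hab fun v hva hvb x y z hx hy hz => by
    by_contra! hne
    refine absurd ((hbig v).1 ?_) (not_or.2 ⟨hva, hvb⟩)
    rw [← Finset.card_eq_three.2 ⟨x, y, z, hne.1, hne.2.1, hne.2.2, rfl⟩,
      ← card_neighborFinset_eq_degree]
    refine Finset.card_le_card fun w hw => ?_
    simp only [Finset.mem_insert, Finset.mem_singleton] at hw
    rw [mem_neighborFinset]
    obtain rfl | rfl | rfl := hw <;> assumption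
  refine ⟨ι, inferInstance, σ, ℓ, hc.nonempty_iso, hc.pos, ?_, ?_⟩
  · rw [sideLengths, Multiset.card_map]
    exact card_filter_side_add_one hc hc.map_left hc.map_right
  · rw [sideLengths, Multiset.card_map]
    exact card_filter_side_add_one hc hc.map_right hc.map_left

lemma deg_eq_degree {V : Type*} (G : SimpleGraph V) (v : V) [Fintype (G.neighborSet v)] :
    deg G v = G.degree v := by
  rw [← card_neighborSet_eq_degree, ← Nat.card_eq_fintype_card]
  rfl

end Reconstruction

/-- a tree whose trunk consists of two (adjacent) vertices of degree at
least 3 is determined by its chromatic symmetric function. -/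
theorem stmt19 {V W : Type*} [Finite V] [Finite W] (T : SimpleGraph V)
    (hc : T.Connected) (ha : T.IsAcyclic)
    (h2 : ∃ a b : V, a ≠ b ∧ T.Adj a b ∧ {v : V | 3 ≤ deg T v} = {a, b})
    (F : SimpleGraph W) (h : csf F = csf T) :
    Nonempty (F ≃g T) := by
  classical
  cases nonempty_fintype V
  cases nonempty_fintype W
  obtain ⟨a, b, -, hab, htrunk⟩ := h2
  have hbig (v) : 3 ≤ T.degree v ↔ v = a ∨ v = b := by
    rw [← deg_eq_degree]
    exact Set.ext_iff.1 htrunk v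
  have hT : T.IsTree := ⟨hc, ha⟩
  obtain ⟨u, v, huv, hbig', hdeg⟩ := exists_trunk_of_csf_eq hT h hab (by convert hbig)
  obtain ⟨ι, _, σ, ℓ, ⟨f⟩, hpos, hu, hv⟩ :=
    exists_finLegGraph_iso (isTree_of_csf_eq hT h) huv hbig'
  obtain ⟨ι', _, σ', ℓ', ⟨g⟩, hpos', ha, hb⟩ := exists_finLegGraph_iso hT hab (by convert hbig)
  have hu3 := (hbig' u).2 (.inl rfl)
  have hv3 := (hbig' v).2 (.inr rfl)
  have ha3 : 3 ≤ (sideLengths σ' ℓ' true).card + 1 := by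
    rw [ha]; convert (hbig a).2 (.inl rfl)
  have hb3 : 3 ≤ (sideLengths σ' ℓ' false).card + 1 := by
    rw [hb]; convert (hbig b).2 (.inr rfl)
  have hmem {ι : Type} [Fintype ι] (σ : ι → Bool) (ℓ : ι → ℕ) (hpos : ∀ i, 0 < ℓ i) :
      ∀ n ∈ sideLengths σ ℓ true + sideLengths σ ℓ false, 0 < n := by
    rw [sideLengths_add]
    intro n hn
    obtain ⟨i, -, rfl⟩ := Multiset.mem_map.1 hn
    exact hpos i
  rcases eq_of_legInvariant_eq (by omega) (by omega) (by omega) (by omega) (by omega)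
    (hmem σ ℓ hpos) (hmem σ' ℓ' hpos') (legInvariant_eq_of_csf_eq h f g) with ⟨h1, h2⟩ | ⟨h1, h2⟩
  · obtain ⟨e⟩ := nonempty_finLegGraph_iso (Bool.forall_bool.2 ⟨h2, h1⟩)
    exact ⟨f.symm.trans (e.trans g)⟩
  · obtain ⟨e⟩ := nonempty_finLegGraph_iso_swap (Bool.forall_bool.2 ⟨h2, h1⟩)
    exact ⟨f.symm.trans (e.trans g)⟩
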